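/- arXiv:1001.1311 — 9 statements merged into one kernel-verified Lean document; each statement's English description precedes it below -/
import Mathlib

section
/- For every positive integer n and every field k of characteristic zero, the general linear group GL_n(k) is a Jordan group; that is, there exists a positive integer J (depending on n) such that every finite subgroup K of GL_n(k) contains a normal abelian subgroup whose index in K is at most J. -/
/-- A group `G` is Jordan if there is a positive integer `J` such that every finite
subgroup `K` of `G` contains a normal abelian subgroup whose index in `K` is at most `J`. -/
def Group.IsJordan (G : Type*) [Group G] : Prop :=
  ∃ J : ℕ, 0 < J ∧ ∀ K : Subgroup G, Finite K →
    ∃ A : Subgroup K, A.Normal ∧ (∀ a b : A, a * b = b * a) ∧ A.index ≤ J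

open scoped Matrix ComplexOrder

/-- Commuting endomorphisms share an eigenvector for any given eigenvalue of the first one. -/
theorem Module.End.HasEigenvalue.exists_common_eigenvector {K V : Type*} [Field K] [IsAlgClosed K]
    [AddCommGroup V] [Module K V] [FiniteDimensional K V] {f g : Module.End K V} {c : K}
    (hc : f.HasEigenvalue c) (hfg : Commute f g) :
    ∃ μ : K, ∃ v : V, v ≠ 0 ∧ f v = c • v ∧ g v = μ • v := by
  have hmaps : ∀ v ∈ f.eigenspace c, g v ∈ f.eigenspace c := fun v hv ↦ by
    rw [Module.End.mem_eigenspace_iff] at hv ⊢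
    rw [← Module.End.mul_apply, hfg.eq, Module.End.mul_apply, hv, map_smul]
  have : Nontrivial (f.eigenspace c) := Submodule.nontrivial_iff_ne_bot.mpr hc
  obtain ⟨μ, hμ⟩ := Module.End.exists_eigenvalue (g.restrict hmaps)
  obtain ⟨v, hv⟩ := hμ.exists_hasEigenvector
  refine ⟨μ, v, fun h ↦ hv.2 (Subtype.ext h), Module.End.mem_eigenspace_iff.mp v.2, ?_⟩
  simpa using congrArg Subtype.val hv.apply_eq_smul

/-- Eigenvectors of a unitary operator for distinct eigenvalues are orthogonal. -/
theorem Unitary.inner_eq_zero_of_apply_eq_smul {H : Type*} [NormedAddCommGroup H]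
    [InnerProductSpace ℂ H] [CompleteSpace H] (g : unitary (H →L[ℂ] H)) {a b : ℂ} {u v : H}
    (hu : (g : H →L[ℂ] H) u = a • u) (hv : (g : H →L[ℂ] H) v = b • v) (hab : a ≠ b) :
    inner ℂ u v = 0 := by
  by_cases hu0 : u = 0
  · simp [hu0]
  have hnorm : ‖a‖ = 1 := by
    have := ContinuousLinearMap.norm_map_of_mem_unitary g.2 u
    rw [hu, norm_smul] at this
    exact mul_right_cancel₀ (norm_ne_zero_iff.mpr hu0) (by rw [this, one_mul])
  have h := ContinuousLinearMap.inner_map_map_of_mem_unitary g.2 u v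
  rw [hu, hv, inner_smul_left, inner_smul_right] at h
  have haa : a * (starRingEnd ℂ) a = 1 := by
    rw [Complex.mul_conj, Complex.normSq_eq_norm_sq, hnorm]; norm_num
  by_contra hne
  have h1 : (starRingEnd ℂ) a * b = 1 :=
    mul_right_cancel₀ hne (by rw [one_mul, mul_assoc]; exact h)
  exact hab (by linear_combination b * haa - a * h1)

section Unitary

variable {H : Type*} [NormedAddCommGroup H] [InnerProductSpace ℂ H] [FiniteDimensional ℂ H]
  [CompleteSpace H]

/-- A nonzero normal operator on a finite-dimensional space has a nonzero eigenvalue. -/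
theorem ContinuousLinearMap.exists_hasEigenvalue_ne_zero {T : H →L[ℂ] H} (hT : IsStarNormal T)
    (h0 : T ≠ 0) : ∃ c : ℂ, c ≠ 0 ∧ Module.End.HasEigenvalue (T : H →ₗ[ℂ] H) c := by
  let W : Submodule ℂ H := (T : H →ₗ[ℂ] H).range
  have hW : Nontrivial W := by
    rw [Submodule.nontrivial_iff_ne_bot, Ne, LinearMap.range_eq_bot]
    exact fun h ↦ h0 (ContinuousLinearMap.coe_injective h)
  have hmaps : ∀ v ∈ W, (T : H →ₗ[ℂ] H) v ∈ W := fun v _ ↦ ⟨v, rfl⟩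
  obtain ⟨c, hc⟩ := Module.End.exists_eigenvalue ((T : H →ₗ[ℂ] H).restrict hmaps)
  obtain ⟨w, hw⟩ := hc.exists_hasEigenvector
  have hTw : T w = c • (w : H) := by simpa using congrArg Subtype.val hw.apply_eq_smul
  have hw0 : (w : H) ≠ 0 := fun h ↦ hw.2 (Subtype.ext h)
  refine ⟨c, fun h ↦ hw0 ?_, Module.End.hasEigenvalue_of_hasEigenvector
    (Module.End.hasEigenvector_iff.mpr ⟨Module.End.mem_eigenspace_iff.mpr hTw, hw0⟩)⟩
  have hker : (w : H) ∈ Wᗮ := by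
    have := ContinuousLinearMap.IsStarNormal.orthogonal_range hT
    change (w : H) ∈ T.rangeᗮ
    rw [this]
    simpa [h] using hTw
  exact inner_self_eq_zero.mp (hker w w.2 : inner ℂ (w : H) w = 0)

/-- Frobenius: if a unitary `g` commutes with its conjugate by a unitary `h` at distance less than
`√2` from the identity, then `g` commutes with `h`. -/
theorem Unitary.commute_of_commute_conj {g h : unitary (H →L[ℂ] H)}
    (hc : Commute g (h * g * h⁻¹)) (hh : ‖(h : H →L[ℂ] H) - 1‖ < √2) : Commute g h := by
  suffices g = h * g * h⁻¹ by
    rw [commute_iff_eq]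
    nth_rewrite 1 [this]
    group
  set g' := h * g * h⁻¹ with hg'
  by_contra hne
  set D : H →L[ℂ] H := (g : H →L[ℂ] H) - g' with hD
  have hD0 : D ≠ 0 := fun h0 ↦ hne (Subtype.ext (sub_eq_zero.mp h0))
  have hcA : Commute (g : H →L[ℂ] H) (g' : H →L[ℂ] H) := congrArg Subtype.val hc.eq
  have hsub {x y : unitary (H →L[ℂ] H)} (hxy : Commute x y) :
      Commute (star (x : H →L[ℂ] H)) (y : H →L[ℂ] H) :=
    congrArg Subtype.val (hxy.inv_left).eq
  have hnormal : IsStarNormal D := by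
    refine ⟨?_⟩
    rw [hD, star_sub]
    exact ((hsub (Commute.refl g)).sub_right (hsub hc)).sub_left
      ((hsub hc.symm).sub_right (hsub (Commute.refl g')))
  obtain ⟨c, hc0, hcD⟩ := ContinuousLinearMap.exists_hasEigenvalue_ne_zero hnormal hD0
  have hDg : Commute (D : H →ₗ[ℂ] H) ((g : H →L[ℂ] H) : H →ₗ[ℂ] H) := by
    have : Commute D (g : H →L[ℂ] H) := (Commute.refl _).sub_left hcA.symm
    exact congrArg (fun T : H →L[ℂ] H ↦ (T : H →ₗ[ℂ] H)) this.eq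
  obtain ⟨μ, v, hv0, hDv, hgv⟩ := hcD.exists_common_eigenvector hDg
  have hgv : (g : H →L[ℂ] H) v = μ • v := hgv
  have hg'v : (g' : H →L[ℂ] H) v = (μ - c) • v := by
    have hDv : (g : H →L[ℂ] H) v - (g' : H →L[ℂ] H) v = c • v := hDv
    rw [hgv] at hDv
    rw [sub_smul, ← hDv]; abel
  set u : H := ((h⁻¹ : unitary (H →L[ℂ] H)) : H →L[ℂ] H) v with hu
  have happ (x y : unitary (H →L[ℂ] H)) (w : H) : ((x * y : unitary (H →L[ℂ] H)) : H →L[ℂ] H) w =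
      (x : H →L[ℂ] H) ((y : H →L[ℂ] H) w) := rfl
  have hhu : (h : H →L[ℂ] H) u = v := by
    rw [hu, ← happ, mul_inv_cancel]; rfl
  have hgu : (g : H →L[ℂ] H) u = (μ - c) • u := by
    have : g * h⁻¹ = h⁻¹ * g' := by rw [hg']; group
    rw [hu, ← happ, this, happ, hg'v, map_smul]
  have horth : inner ℂ v u = 0 :=
    Unitary.inner_eq_zero_of_apply_eq_smul g hgv hgu (fun h ↦ hc0 (by linear_combination h))
  have hnu : ‖v‖ = ‖u‖ := by
    rw [← hhu]; exact ContinuousLinearMap.norm_map_of_mem_unitary h.2 u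
  have hupos : 0 < ‖u‖ := hnu ▸ norm_pos_iff.mpr hv0
  have hle : ‖v - u‖ ≤ ‖(h : H →L[ℂ] H) - 1‖ * ‖u‖ := by
    have := ((h : H →L[ℂ] H) - 1).le_opNorm u
    rwa [sub_apply, hhu] at this
  have hlt : ‖v - u‖ < √2 * ‖u‖ := hle.trans_lt (mul_lt_mul_of_pos_right hh hupos)
  have hsq : ‖v - u‖ ^ 2 = 2 * ‖u‖ ^ 2 := by
    rw [norm_sub_sq (𝕜 := ℂ), horth, hnu]; simp; ring
  have := pow_lt_pow_left₀ hlt (norm_nonneg _) two_ne_zero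
  rw [mul_pow, Real.sq_sqrt zero_le_two, hsq] at this
  exact lt_irrefl _ this

end Unitary

/-- The distance from the commutator of two unitaries to the identity is at most twice the product
of their distances to the identity. -/
theorem Unitary.norm_commutator_sub_one_le {A : Type*} [NormedRing A] [StarRing A] [CStarRing A]
    (g h : unitary A) :
    ‖((g * h * g⁻¹ * h⁻¹ : unitary A) : A) - 1‖ ≤ 2 * ‖(g : A) - 1‖ * ‖(h : A) - 1‖ := by
  have key : (((g * h * g⁻¹ * h⁻¹ : unitary A) : A) - 1) * ((h * g : unitary A) : A) =
      ((g : A) - 1) * ((h : A) - 1) - ((h : A) - 1) * ((g : A) - 1) := by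
    rw [sub_mul, ← Submonoid.coe_mul, show g * h * g⁻¹ * h⁻¹ * (h * g) = g * h by group,
      Submonoid.coe_mul, Submonoid.coe_mul]
    noncomm_ring
  rw [← CStarRing.norm_mul_coe_unitary _ (h * g), key]
  calc _ ≤ ‖((g : A) - 1) * ((h : A) - 1)‖ + ‖((h : A) - 1) * ((g : A) - 1)‖ := norm_sub_le _ _
    _ ≤ ‖(g : A) - 1‖ * ‖(h : A) - 1‖ + ‖(h : A) - 1‖ * ‖(g : A) - 1‖ :=
      add_le_add (norm_mul_le _ _) (norm_mul_le _ _)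
    _ = _ := by ring

section Representation

variable {H : Type*} [NormedAddCommGroup H] [InnerProductSpace ℂ H] [FiniteDimensional ℂ H]
  [CompleteSpace H] {K : Type*} [Group K]

/-- Elements of a finite group of unitaries that are close to the identity commute. -/
theorem Unitary.commute_of_norm_sub_one_lt [Finite K] {ρ : K →* unitary (H →L[ℂ] H)}
    (hρ : Function.Injective ρ) {g : K} (hg : ‖(ρ g : H →L[ℂ] H) - 1‖ < 1 / 2) (h : K)
    (hh : ‖(ρ h : H →L[ℂ] H) - 1‖ < 1 / 2) : Commute g h := by
  let d : K → ℝ := fun x ↦ ‖(ρ x : H →L[ℂ] H) - 1‖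
  have : IsTrans K (InvImage (· < ·) d) := ⟨fun a b c hab hbc ↦ lt_trans (a := d a) hab hbc⟩
  have : Std.Irrefl (InvImage (· < ·) d) := ⟨fun a ↦ lt_irrefl (d a)⟩
  have wf : WellFounded (InvImage (· < ·) d) := Finite.wellFounded_of_trans_of_irrefl _
  induction h using wf.induction with
  | _ h ih =>
  by_cases h1 : h = 1
  · rw [h1]; exact Commute.one_right g
  have hpos : 0 < ‖(ρ h : H →L[ℂ] H) - 1‖ := by
    refine norm_pos_iff.mpr fun h0 ↦ h1 (hρ ?_)
    rw [map_one]
    exact Subtype.ext (sub_eq_zero.mp h0)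
  have hlt : ‖(ρ (g * h * g⁻¹ * h⁻¹) : H →L[ℂ] H) - 1‖ < ‖(ρ h : H →L[ℂ] H) - 1‖ := by
    have := Unitary.norm_commutator_sub_one_le (ρ g) (ρ h)
    simp only [map_mul, map_inv]
    nlinarith
  have hcomm : Commute g (g * h * g⁻¹ * h⁻¹) := ih _ hlt (hlt.trans hh)
  have hconj : Commute g (h * g * h⁻¹) := by
    have h2 : h * g * h⁻¹ = (g⁻¹ * (g * h * g⁻¹ * h⁻¹))⁻¹ := by group
    rw [h2]
    exact (((Commute.refl g).inv_right).mul_right hcomm).inv_right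
  have hsqrt : (1 / 2 : ℝ) < √2 := by
    have : (1 : ℝ) ≤ √2 := Real.one_le_sqrt.mpr one_le_two
    linarith
  have := Unitary.commute_of_commute_conj (g := ρ g) (h := ρ h)
    (by simpa using hconj.map ρ) (hh.trans hsqrt)
  exact hρ (by simpa using this.eq)

/-- Jordan's theorem for finite groups of unitary operators on a fixed space. -/
theorem Unitary.exists_index_le_of_finite.{u, v} (H : Type v) [NormedAddCommGroup H]
    [InnerProductSpace ℂ H] [FiniteDimensional ℂ H] [CompleteSpace H] :
    ∃ N : ℕ, ∀ (K : Type u) [Group K] [Finite K] (ρ : K →* unitary (H →L[ℂ] H)),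
      Function.Injective ρ →
      ∃ A : Subgroup K, A.Normal ∧ (∀ a b : A, a * b = b * a) ∧ A.index ≤ N := by
  have : ProperSpace (H →L[ℂ] H) := FiniteDimensional.proper ℂ _
  obtain ⟨t, -, htfin, ht⟩ := (isCompact_closedBall (0 : H →L[ℂ] H)
    ‖(1 : H →L[ℂ] H)‖).finite_cover_balls (e := 1 / 4) (by norm_num)
  refine ⟨Nat.card t, fun K _ _ ρ hρ ↦ ?_⟩
  let S : Set K := {g | ‖(ρ g : H →L[ℂ] H) - 1‖ < 1 / 2}
  have hS : ∀ g ∈ S, ∀ k : K, k * g * k⁻¹ ∈ S := fun g hg k ↦ by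
    have : (ρ (k * g * k⁻¹) : H →L[ℂ] H) - 1 =
        (ρ k : H →L[ℂ] H) * ((ρ g : H →L[ℂ] H) - 1) * (ρ k⁻¹ : H →L[ℂ] H) := by
      rw [mul_sub, sub_mul, mul_one, ← Submonoid.coe_mul, ← Submonoid.coe_mul,
        ← Submonoid.coe_mul, ← map_mul, ← map_mul, ← map_mul, mul_inv_cancel, map_one]
      rfl
    change ‖_‖ < _
    rw [this, CStarRing.norm_mul_coe_unitary, CStarRing.norm_coe_unitary_mul]
    exact hg
  refine ⟨Subgroup.closure S, ?_, ?_, ?_⟩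
  · have hconj : Group.conjugatesOfSet S = S :=
      Set.Subset.antisymm (fun x hx ↦ by
        obtain ⟨g, hg, hgx⟩ := Group.mem_conjugatesOfSet_iff.mp hx
        obtain ⟨k, rfl⟩ := isConj_iff.mp hgx
        exact hS g hg k) Group.subset_conjugatesOfSet
    have : Subgroup.closure S = Subgroup.normalClosure S := by
      rw [Subgroup.normalClosure, hconj]
    rw [this]
    infer_instance
  · have := Subgroup.isMulCommutative_closure (k := S) fun x hx y hy ↦
      (Unitary.commute_of_norm_sub_one_lt hρ hx y hy).eq
    exact mul_comm'
  · have hcenter (x : K) : ∃ c : t, ‖(ρ x : H →L[ℂ] H) - c‖ < 1 / 4 := by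
      have hx : (ρ x : H →L[ℂ] H) ∈ Metric.closedBall (0 : H →L[ℂ] H) ‖(1 : H →L[ℂ] H)‖ := by
        rw [mem_closedBall_zero_iff, ← mul_one (ρ x : H →L[ℂ] H),
          CStarRing.norm_coe_unitary_mul]
      obtain ⟨c, hc, hxc⟩ := Set.mem_iUnion₂.mp (ht hx)
      exact ⟨⟨c, hc⟩, mem_ball_iff_norm.mp hxc⟩
    choose c hc using hcenter
    have : Finite t := htfin
    refine Nat.card_le_card_of_injective (fun q : K ⧸ Subgroup.closure S ↦ c q.out)
      fun p q hpq ↦ ?_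
    rw [← p.out_eq', ← q.out_eq', QuotientGroup.eq]
    refine Subgroup.subset_closure ?_
    have hpq : c p.out = c q.out := hpq
    generalize p.out = x, q.out = y at hpq
    change ‖_‖ < _
    have h1 := hc x
    have h2 := hc y
    have heq : (ρ (x⁻¹ * y) : H →L[ℂ] H) - 1 =
        (ρ x⁻¹ : H →L[ℂ] H) * ((ρ y : H →L[ℂ] H) - (ρ x : H →L[ℂ] H)) := by
      rw [mul_sub, ← Submonoid.coe_mul, ← Submonoid.coe_mul, ← map_mul, ← map_mul,
        inv_mul_cancel, map_one]
      rfl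
    rw [heq, CStarRing.norm_coe_unitary_mul]
    rw [← hpq] at h2
    rw [norm_sub_rev] at h1
    linarith [norm_sub_le_norm_sub_add_norm_sub (ρ y : H →L[ℂ] H) (c x : H →L[ℂ] H) (ρ x)]

end Representation

open scoped MatrixOrder Matrix.Norms.L2Operator in
/-- Weyl's unitary trick: a faithful complex matrix representation of a finite group can be made
unitary. -/
theorem Matrix.exists_injective_unitary_of_finite {ι K : Type*} [Fintype ι] [DecidableEq ι]
    [Group K] [Finite K] {ρ : K →* Matrix ι ι ℂ} (hρ : Function.Injective ρ) :
    ∃ σ : K →* unitary (Matrix ι ι ℂ), Function.Injective σ := by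
  have := Fintype.ofFinite K
  let P : Matrix ι ι ℂ := ∑ g : K, (ρ g)ᴴ * ρ g
  have hunit (g : K) : IsUnit (ρ g) := (Group.isUnit g).map ρ
  have hP : P.PosDef := Matrix.posDef_sum Finset.univ_nonempty fun g _ ↦
    Matrix.PosDef.conjTranspose_mul_self _ (Matrix.mulVec_injective_iff_isUnit.mpr (hunit g))
  have hinv (k : K) : (ρ k)ᴴ * P * ρ k = P := by
    simp only [P, Finset.mul_sum, Finset.sum_mul]
    refine Fintype.sum_equiv (Equiv.mulRight k) _ _ fun g ↦ ?_
    simp [Matrix.conjTranspose_mul, mul_assoc]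
  obtain ⟨B, hB⟩ : ∃ B : Matrix ι ι ℂ, P = Bᴴ * B :=
    CStarAlgebra.nonneg_iff_eq_star_mul_self.mp hP.posSemidef.nonneg
  have hBu : IsUnit B := by
    have := hP.isUnit
    rw [hB] at this
    exact isUnit_of_mul_isUnit_right this
  obtain ⟨B, rfl⟩ := hBu
  let C : Matrix ι ι ℂ := ↑B⁻¹
  have hCB : C * B = 1 := B.inv_mul
  have hBC : (B : Matrix ι ι ℂ) * C = 1 := B.mul_inv
  have hBC' : Cᴴ * (B : Matrix ι ι ℂ)ᴴ = 1 := by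
    rw [← Matrix.conjTranspose_mul, hBC, Matrix.conjTranspose_one]
  have hmem (g : K) : (B : Matrix ι ι ℂ) * ρ g * C ∈ unitary (Matrix ι ι ℂ) := by
    have h1 : star ((B : Matrix ι ι ℂ) * ρ g * C) * (B * ρ g * C) = 1 := by
      calc star ((B : Matrix ι ι ℂ) * ρ g * C) * (B * ρ g * C)
          = Cᴴ * ((ρ g)ᴴ * ((B : Matrix ι ι ℂ)ᴴ * B) * ρ g) * C := by
            simp only [Matrix.star_eq_conjTranspose, Matrix.conjTranspose_mul, mul_assoc]
        _ = 1 := by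
            rw [← hB, hinv, hB, ← mul_assoc, hBC', one_mul, hBC]
    exact Unitary.mem_iff.mpr ⟨h1, mul_eq_one_comm.mp h1⟩
  refine ⟨{ toFun := fun g ↦ ⟨_, hmem g⟩, map_one' := ?_, map_mul' := fun g h ↦ ?_ },
    fun g h hgh ↦ hρ ?_⟩
  · exact Subtype.ext (by simp [hBC])
  · refine Subtype.ext ?_
    simp only [map_mul, Submonoid.coe_mul]
    calc (B : Matrix ι ι ℂ) * (ρ g * ρ h) * C = B * ρ g * 1 * ρ h * C := by
          simp only [mul_assoc, one_mul]
      _ = _ := by rw [← hCB]; simp only [mul_assoc]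
  · have hgh : (B : Matrix ι ι ℂ) * ρ g * C = B * ρ h * C := congrArg Subtype.val hgh
    have hgh := congrArg (fun M ↦ C * M * B) hgh
    simpa [mul_assoc, hCB, ← mul_assoc C] using hgh

/-- A countable field of characteristic zero embeds into `ℂ`. -/
theorem nonempty_ringHom_complex_of_countable (F : Type*) [Field F] [CharZero F] [Countable F] :
    Nonempty (F →+* ℂ) := by
  obtain ⟨s, hs⟩ := exists_isTranscendenceBasis ℤ F
  obtain ⟨t, ht⟩ := exists_isTranscendenceBasis ℤ ℂ
  have htc : Cardinal.mk ℂ = Cardinal.mk t :=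
    IsAlgClosed.cardinal_eq_cardinal_transcendence_basis_of_aleph0_lt' _ ht
      Cardinal.mk_le_aleph0 (by rw [Cardinal.mk_complex]; exact Cardinal.aleph0_lt_continuum)
  have : Infinite t := Cardinal.infinite_iff.mpr
    (by rw [← htc, Cardinal.mk_complex]; exact Cardinal.aleph0_lt_continuum.le)
  obtain ⟨e, he⟩ := Countable.exists_injective_nat s
  let i : s → t := fun x ↦ Infinite.natEmbedding t (e x)
  have hi : Function.Injective i := (Infinite.natEmbedding t).injective.comp he
  have hind : AlgebraicIndependent ℤ ((Subtype.val : t → ℂ) ∘ i) := ht.1.comp i hi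
  let φ : Algebra.adjoin ℤ (Set.range (Subtype.val : s → F)) →+* ℂ :=
    (MvPolynomial.aeval ((Subtype.val : t → ℂ) ∘ i)).toRingHom.comp
      hs.1.aevalEquiv.symm.toRingEquiv.toRingHom
  have hφ : Function.Injective φ := by
    refine Function.Injective.comp (g := MvPolynomial.aeval ((Subtype.val : t → ℂ) ∘ i)) ?_
      hs.1.aevalEquiv.symm.injective
    exact hind
  let := φ.toAlgebra
  have : FaithfulSMul (Algebra.adjoin ℤ (Set.range (Subtype.val : s → F))) ℂ :=
    (faithfulSMul_iff_algebraMap_injective _ _).mpr hφ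
  have := hs.isAlgebraic
  exact ⟨(IsAlgClosed.lift : F →ₐ[Algebra.adjoin ℤ (Set.range (Subtype.val : s → F))] ℂ).toRingHom⟩

/-- A finite group of matrices over a field of characteristic zero has a faithful complex matrix
representation of the same degree. -/
theorem Matrix.exists_injective_complex_of_finite {ι K k : Type*} [Fintype ι] [DecidableEq ι]
    [Group K] [Finite K] [Field k] [CharZero k] {ρ : K →* Matrix ι ι k}
    (hρ : Function.Injective ρ) : ∃ σ : K →* Matrix ι ι ℂ, Function.Injective σ := by
  let s : Set k := Set.range fun p : K × ι × ι ↦ ρ p.1 p.2.1 p.2.2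
  let F : Subfield k := Subfield.closure s
  have : Countable F := by
    rw [← Cardinal.mk_le_aleph0_iff]
    exact (Subfield.cardinalMk_closure_le_max s).trans
      (max_le (Set.finite_range _).countable.le_aleph0 le_rfl)
  have hmem (g : K) (i j : ι) : ρ g i j ∈ F := Subfield.subset_closure ⟨(g, i, j), rfl⟩
  obtain ⟨f⟩ := nonempty_ringHom_complex_of_countable F
  have hinj : Function.Injective (F.subtype.mapMatrix (m := ι)) :=
    Matrix.map_injective Subtype.val_injective
  let τ (g : K) : Matrix ι ι F := Matrix.of fun i j ↦ ⟨ρ g i j, hmem g i j⟩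
  have hτ (g : K) : F.subtype.mapMatrix (τ g) = ρ g := rfl
  let τ' : K →* Matrix ι ι F :=
    { toFun := τ
      map_one' := hinj (by rw [hτ, map_one, map_one])
      map_mul' := fun g h ↦ hinj (by rw [map_mul, hτ, hτ, hτ, map_mul]) }
  refine ⟨(f.mapMatrix (m := ι)).toMonoidHom.comp τ', ?_⟩
  refine Function.Injective.comp (g := f.mapMatrix (m := ι)) (Matrix.map_injective f.injective)
    fun g h hgh ↦ hρ ?_
  rw [← hτ g, ← hτ h]
  exact congrArg _ hgh

theorem GL_isJordan (k : Type*) [Field k] [CharZero k] (n : ℕ) (hn : 0 < n) :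
    Group.IsJordan (Matrix.GeneralLinearGroup (Fin n) k) := by
  obtain ⟨N, hN⟩ := Unitary.exists_index_le_of_finite (EuclideanSpace ℂ (Fin n))
  refine ⟨N + 1, N.succ_pos, fun K _ ↦ ?_⟩
  obtain ⟨ρ, hρ⟩ := Matrix.exists_injective_complex_of_finite
    (ρ := (Units.coeHom (Matrix (Fin n) (Fin n) k)).comp K.subtype)
    (Units.val_injective.comp Subtype.val_injective)
  obtain ⟨σ, hσ⟩ := Matrix.exists_injective_unitary_of_finite hρ
  let f : Matrix (Fin n) (Fin n) ℂ →⋆* (EuclideanSpace ℂ (Fin n) →L[ℂ] EuclideanSpace ℂ (Fin n)) :=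
    { (Matrix.toEuclideanCLM (n := Fin n) (𝕜 := ℂ) : _ →* _) with map_star' := map_star _ }
  have hf : Function.Injective f := (Matrix.toEuclideanCLM (n := Fin n) (𝕜 := ℂ)).injective
  obtain ⟨A, hA, hcomm, hindex⟩ := hN K ((Unitary.map f).toMonoidHom.comp σ)
    ((Unitary.map_injective hf).comp hσ)
  exact ⟨A, hA, hcomm, hindex.trans N.le_succ⟩
end

section
/- Let k be a field of characteristic zero, let n be a positive integer, and let G be a group admitting an injective group homomorphism into GL_n(k). Then G is a Jordan group. -/
section NormedRing

open scoped commutatorElement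

variable {R : Type*} [NormedRing R]

/-- There are no small multiplicative submonoids: if all powers of `d` stay within a
distance `c < 1` of `1`, then `d = 1`. -/
theorem eq_one_of_forall_norm_pow_sub_one_le [NormedAlgebra ℝ R] {d : R} {c : ℝ} (hc : c < 1)
    (h : ∀ k : ℕ, ‖d ^ k - 1‖ ≤ c) : d = 1 := by
  by_contra hd
  have hpos : 0 < ‖d - 1‖ := norm_pos_iff.2 (sub_ne_zero.2 hd)
  have hgrow : ∀ j : ℕ, (2 - c) ^ j * ‖d - 1‖ ≤ ‖d ^ 2 ^ j - 1‖ := by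
    intro j
    induction j with
    | zero => simp
    | succ j ih =>
      set x : R := d ^ 2 ^ j - 1 with hx
      have hsq : d ^ 2 ^ (j + 1) - 1 = (2 : ℝ) • x + x * x := by
        rw [pow_succ, pow_mul, hx, two_smul]
        noncomm_ring
      have hle : 2 * ‖x‖ ≤ ‖(2 : ℝ) • x + x * x‖ + ‖x‖ * ‖x‖ := by
        calc 2 * ‖x‖ = ‖(2 : ℝ) • x + x * x - x * x‖ := by
              rw [add_sub_cancel_right, norm_smul, Real.norm_two]
          _ ≤ ‖(2 : ℝ) • x + x * x‖ + ‖x * x‖ := norm_sub_le _ _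
          _ ≤ _ := by gcongr; exact norm_mul_le _ _
      have hxc : ‖x‖ ≤ c := h (2 ^ j)
      rw [hsq, pow_succ]
      nlinarith [norm_nonneg x]
  obtain ⟨j, hj⟩ := ((tendsto_pow_atTop_atTop_of_one_lt (by linarith : 1 < 2 - c)).eventually
    (Filter.eventually_gt_atTop (c / ‖d - 1‖))).exists
  have := (div_lt_iff₀ hpos).1 hj
  linarith [hgrow j, h (2 ^ j)]

variable {K : Type*} [Group K] {ρ : K →* R}

theorem norm_map_commutator_sub_one_le (hρ : ∀ g, ‖ρ g‖ ≤ 1) (x y : K) :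
    ‖ρ ⁅x, y⁆ - 1‖ ≤ ‖(ρ x - 1) * (ρ y - 1) - (ρ y - 1) * (ρ x - 1)‖ := by
  have h : ρ ⁅x, y⁆ - 1 =
      ((ρ x - 1) * (ρ y - 1) - (ρ y - 1) * (ρ x - 1)) * ρ (x⁻¹ * y⁻¹) := by
    have h₁ : (ρ x - 1) * (ρ y - 1) - (ρ y - 1) * (ρ x - 1) = ρ (x * y) - ρ (y * x) := by
      rw [map_mul, map_mul]
      noncomm_ring
    rw [h₁, sub_mul, ← map_mul, ← map_mul, commutatorElement_def]
    congr 2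
    · group
    · rw [← map_one ρ]
      congr 1
      group
  rw [h]
  exact (norm_mul_le _ _).trans (mul_le_of_le_one_right (norm_nonneg _) (hρ _))

theorem norm_map_commutator_sub_one_le_two_mul_mul (hρ : ∀ g, ‖ρ g‖ ≤ 1) (x y : K) :
    ‖ρ ⁅x, y⁆ - 1‖ ≤ 2 * ‖ρ x - 1‖ * ‖ρ y - 1‖ := by
  refine (norm_map_commutator_sub_one_le hρ x y).trans ((norm_sub_le _ _).trans ?_)
  linarith [norm_mul_le (ρ x - 1) (ρ y - 1), norm_mul_le (ρ y - 1) (ρ x - 1)]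

theorem norm_map_commutator_sub_one_le_two_mul (hρ : ∀ g, ‖ρ g‖ ≤ 1) (x y : K) :
    ‖ρ ⁅x, y⁆ - 1‖ ≤ 2 * ‖ρ x - 1‖ := by
  refine (norm_map_commutator_sub_one_le hρ x y).trans ?_
  have h : (ρ x - 1) * (ρ y - 1) - (ρ y - 1) * (ρ x - 1) =
      (ρ x - 1) * ρ y - ρ y * (ρ x - 1) := by noncomm_ring
  rw [h]
  refine (norm_sub_le _ _).trans ?_
  have h₁ := (norm_mul_le (ρ x - 1) (ρ y)).trans
    (mul_le_of_le_one_right (norm_nonneg _) (hρ y))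
  have h₂ := (norm_mul_le (ρ y) (ρ x - 1)).trans
    (mul_le_of_le_one_left (norm_nonneg _) (hρ y))
  linarith

/-- If `b` is close to `1` and `a` commutes with `⁅b, a⁆`, then `a` commutes with `b`. -/
theorem commute_of_commute_commutator [NormedAlgebra ℝ R] (hρ : ∀ g, ‖ρ g‖ ≤ 1)
    (hinj : Function.Injective ρ) {a b : K} (hb : ‖ρ b - 1‖ < 1 / 2)
    (hab : Commute ⁅b, a⁆ a) : Commute b a := by
  have hpow : ∀ k : ℕ, ⁅b, a⁆ ^ k = ⁅b, a ^ k⁆ := by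
    intro k
    have h : (⁅b, a⁆ * a) ^ k = b * a ^ k * b⁻¹ := by
      rw [← conj_pow, commutatorElement_def, inv_mul_cancel_right]
    rw [hab.mul_pow] at h
    rw [commutatorElement_def b (a ^ k), ← h, mul_inv_cancel_right]
  rw [commute_iff_eq, ← commutatorElement_eq_one_iff_mul_comm]
  apply hinj
  rw [map_one]
  refine eq_one_of_forall_norm_pow_sub_one_le (c := 2 * ‖ρ b - 1‖) (by linarith) fun k ↦ ?_
  rw [← map_pow, hpow]
  exact norm_map_commutator_sub_one_le_two_mul hρ b _

/-- In a finite group of contractions, any two elements close to `1` commute. -/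
theorem commute_of_norm_map_sub_one_lt [NormedAlgebra ℝ R] [Finite K] (hρ : ∀ g, ‖ρ g‖ ≤ 1)
    (hinj : Function.Injective ρ) {a b : K} (ha : ‖ρ a - 1‖ < 1 / 4)
    (hb : ‖ρ b - 1‖ < 1 / 4) : Commute b a := by
  by_contra hab
  obtain ⟨c, ⟨hc, hca⟩, hmin⟩ := Set.exists_min_image
    {x : K | ‖ρ x - 1‖ < 1 / 4 ∧ ¬ Commute x a} (fun x ↦ ‖ρ x - 1‖) (Set.toFinite _) ⟨b, hb, hab⟩
  have hpos : 0 < ‖ρ c - 1‖ := by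
    refine norm_pos_iff.2 (sub_ne_zero.2 fun h ↦ hca ?_)
    rw [hinj (h.trans (map_one ρ).symm)]
    exact Commute.one_left a
  have hlt : ‖ρ ⁅c, a⁆ - 1‖ < ‖ρ c - 1‖ := by
    have := norm_map_commutator_sub_one_le_two_mul_mul hρ c a
    nlinarith
  refine hca (commute_of_commute_commutator hρ hinj (by linarith) ?_)
  by_contra h
  exact (hmin _ ⟨hlt.trans hc, h⟩).not_gt hlt

/-- A finite group of contractions in a finite-dimensional normed algebra has a normal abelian
subgroup whose index is bounded in terms of the algebra only. -/
theorem exists_normal_abelian_index_le_of_norm_le_one (R : Type*) [NormedRing R]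
    [NormedAlgebra ℝ R] [ProperSpace R] :
    ∃ J : ℕ, ∀ (K : Type*) [Group K] [Finite K] (ρ : K →* R), Function.Injective ρ →
      (∀ g, ‖ρ g‖ ≤ 1) →
        ∃ A : Subgroup K, A.Normal ∧ (∀ a b : A, a * b = b * a) ∧ A.index ≤ J := by
  obtain ⟨t, -, htfin, ht⟩ := finite_cover_balls_of_compact
    (isCompact_closedBall (0 : R) 1) (by norm_num : (0 : ℝ) < 1 / 8)
  refine ⟨t.ncard, fun K _ _ ρ hinj hρ ↦ ?_⟩
  set s : Set K := {g | ‖ρ g - 1‖ < 1 / 4}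
  refine ⟨Subgroup.closure s, ?_, ?_, ?_⟩
  · refine ⟨fun n hn g ↦ ?_⟩
    induction hn using Subgroup.closure_induction with
    | mem x hx =>
      refine Subgroup.subset_closure ?_
      have h : ρ (g * x * g⁻¹) - 1 = ρ g * (ρ x - 1) * ρ g⁻¹ := by
        rw [mul_sub, sub_mul, mul_one, ← map_mul, ← map_mul, ← map_mul, mul_inv_cancel, map_one]
      calc ‖ρ (g * x * g⁻¹) - 1‖ ≤ ‖ρ g‖ * ‖ρ x - 1‖ * ‖ρ g⁻¹‖ := by
            rw [h]
            exact (norm_mul_le _ _).trans (by gcongr; exact norm_mul_le _ _)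
        _ ≤ 1 * ‖ρ x - 1‖ * 1 := by gcongr <;> exact hρ _
        _ < 1 / 4 := by rwa [one_mul, mul_one]
    | one => simp
    | mul x y _ _ hx hy =>
      rw [← conj_mul]
      exact mul_mem hx hy
    | inv x _ hx =>
      rw [← conj_inv]
      exact inv_mem hx
  · have := Subgroup.isMulCommutative_closure (k := s) fun x hx y hy ↦
      commute_of_norm_map_sub_one_lt hρ hinj hy hx
    exact fun a b ↦ mul_comm' a b
  · have hcov : ∀ g : K, ∃ x ∈ t, dist (ρ g) x < 1 / 8 := fun g ↦ by
      simpa using ht (mem_closedBall_zero_iff.2 (hρ g))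
    choose φ hφt hφ using hcov
    rw [Subgroup.index, ← Nat.card_coe_set_eq]
    have := htfin.to_subtype
    refine Nat.card_le_card_of_injective
      (fun q : K ⧸ Subgroup.closure s ↦ (⟨φ q.out, hφt _⟩ : t)) fun p q hpq ↦ ?_
    have hdist : ‖ρ q.out - ρ p.out‖ < 1 / 4 := by
      rw [← dist_eq_norm]
      have h₁ := hφ p.out
      rw [Subtype.mk.injEq] at hpq
      rw [hpq, dist_comm] at h₁
      linarith [dist_triangle (ρ q.out) (φ q.out) (ρ p.out), hφ q.out]
    rw [← p.out_eq, ← q.out_eq, QuotientGroup.eq]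
    refine Subgroup.subset_closure ?_
    have h : ρ (p.out⁻¹ * q.out) - 1 = ρ p.out⁻¹ * (ρ q.out - ρ p.out) := by
      rw [mul_sub, ← map_mul, ← map_mul, inv_mul_cancel, map_one]
    calc ‖ρ (p.out⁻¹ * q.out) - 1‖ ≤ ‖ρ p.out⁻¹‖ * ‖ρ q.out - ρ p.out‖ := by
          rw [h]
          exact norm_mul_le _ _
      _ ≤ 1 * ‖ρ q.out - ρ p.out‖ := by gcongr; exact hρ _
      _ < 1 / 4 := by rwa [one_mul]

end NormedRing

/-- Weyl's unitary trick: every finite group of units in a C⋆-algebra can be conjugated into a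
group of contractions. -/
theorem exists_injective_forall_norm_le_one {A : Type*} [CStarAlgebra A] [PartialOrder A]
    [StarOrderedRing A] {K : Type*} [Group K] [Finite K] (ρ : K →* A)
    (hinj : Function.Injective ρ) :
    ∃ ρ' : K →* A, Function.Injective ρ' ∧ ∀ g, ‖ρ' g‖ ≤ 1 := by
  cases nonempty_fintype K
  set P : A := ∑ h, star (ρ h) * ρ h with hP
  have hpos : IsStrictlyPositive P := by
    have hle : (1 : A) ≤ P := by
      have := Finset.single_le_sum (f := fun h ↦ star (ρ h) * ρ h)
        (fun h _ ↦ star_mul_self_nonneg (ρ h)) (Finset.mem_univ (1 : K))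
      simpa using this
    exact IsStrictlyPositive.of_le isStrictlyPositive_one hle
  obtain ⟨_, ⟨S, rfl⟩, hS⟩ := CStarAlgebra.isStrictlyPositive_iff_eq_star_mul_self.1 hpos
  let ρ' : K →* A :=
    { toFun g := S * ρ g * (↑S⁻¹ : A)
      map_one' := by simp
      map_mul' g h := by simp [mul_assoc] }
  refine ⟨ρ', fun g h hgh ↦ hinj ?_, fun g ↦ ?_⟩
  · exact S.isUnit.mul_left_cancel (S⁻¹.isUnit.mul_right_cancel hgh)
  have hinv : star (ρ g) * P * ρ g = P := by
    rw [hP, Finset.mul_sum, Finset.sum_mul]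
    refine Fintype.sum_equiv (Equiv.mulRight g) _ _ fun h ↦ ?_
    simp [mul_assoc]
  have hone : star (ρ' g) * ρ' g = 1 := by
    calc star (ρ' g) * ρ' g
        = star (↑S⁻¹ : A) * (star (ρ g) * (star (S : A) * S) * ρ g) * (↑S⁻¹ : A) := by
          simp only [ρ', MonoidHom.coe_mk, OneHom.coe_mk, star_mul, mul_assoc]
      _ = star ((S : A) * (↑S⁻¹ : A)) * ((S : A) * (↑S⁻¹ : A)) := by
          rw [← hS, hinv, hS]
          simp only [star_mul, mul_assoc]
      _ = 1 := by simp
  have hnorm := CStarRing.norm_star_mul_self (x := ρ' g)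
  have hnorm_one := CStarRing.norm_star_mul_self (x := (1 : A))
  rw [hone] at hnorm
  rw [star_one, mul_one] at hnorm_one
  have : ‖(1 : A)‖ ≤ 1 := by nlinarith [norm_nonneg (1 : A)]
  nlinarith [norm_nonneg (ρ' g)]

open scoped Matrix.Norms.L2Operator MatrixOrder in
/-- **Jordan's theorem** over the complex numbers. -/
theorem exists_normal_abelian_index_le_of_complex_matrix (n : ℕ) :
    ∃ J : ℕ, ∀ (K : Type*) [Group K] [Finite K] (ρ : K →* Matrix (Fin n) (Fin n) ℂ),
      Function.Injective ρ →
        ∃ A : Subgroup K, A.Normal ∧ (∀ a b : A, a * b = b * a) ∧ A.index ≤ J := by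
  have : ProperSpace (Matrix (Fin n) (Fin n) ℂ) := FiniteDimensional.proper ℂ _
  obtain ⟨J, hJ⟩ :=
    exists_normal_abelian_index_le_of_norm_le_one (Matrix (Fin n) (Fin n) ℂ)
  refine ⟨J, fun K _ _ ρ hinj ↦ ?_⟩
  obtain ⟨ρ', hinj', hρ'⟩ := exists_injective_forall_norm_le_one ρ hinj
  exact hJ K ρ' hinj' hρ'

open Cardinal in
/-- A countable domain of characteristic zero embeds into the complex numbers. -/
theorem exists_injective_ringHom_complex (L : Type*) [CommRing L] [IsDomain L] [Algebra ℚ L]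
    [Countable L] : ∃ φ : L →+* ℂ, Function.Injective φ := by
  obtain ⟨s, hs⟩ := exists_isTranscendenceBasis ℚ L
  obtain ⟨t, ht⟩ := exists_isTranscendenceBasis ℚ ℂ
  have hcard := IsAlgClosed.cardinal_eq_cardinal_transcendence_basis_of_aleph0_lt' _ ht
    (by simp) (by simp [aleph0_lt_continuum])
  obtain ⟨ι⟩ : Nonempty (s ↪ t) := by
    rw [← Cardinal.lift_mk_le', ← hcard]
    refine (lift_le_aleph0.2 mk_le_aleph0).trans ?_
    simp [aleph0_le_continuum]
  have hind : AlgebraicIndependent ℚ (fun x : s ↦ (ι x : ℂ)) := ht.1.comp ι ι.injective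
  let R := Algebra.adjoin ℚ (Set.range ((↑) : s → L))
  let ψ : R →ₐ[ℚ] ℂ :=
    (MvPolynomial.aeval fun x : s ↦ (ι x : ℂ)).comp hs.1.aevalEquiv.symm.toAlgHom
  have hψ : Function.Injective ψ :=
    (algebraicIndependent_iff_injective_aeval.1 hind).comp hs.1.aevalEquiv.symm.injective
  let : Algebra R ℂ := ψ.toRingHom.toAlgebra
  have : Module.IsTorsionFree R ℂ := Module.isTorsionFree_iff_algebraMap_injective.2 hψ
  have : Algebra.IsAlgebraic R L := hs.isAlgebraic
  let φ : L →ₐ[R] ℂ := IsAlgClosed.lift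
  refine ⟨φ.toRingHom, (injective_iff_map_eq_zero _).2 fun x hx ↦ ?_⟩
  by_contra hx0
  refine Ideal.comap_ne_bot_of_algebraic_mem (I := RingHom.ker φ.toRingHom) hx0 hx
    (Algebra.IsAlgebraic.isAlgebraic (R := R) x) ((Submodule.eq_bot_iff _).2 fun r hr ↦ hψ ?_)
  rw [map_zero]
  exact (φ.commutes r).symm.trans hr

theorem isJordan_of_injective_into_GL (k : Type*) [Field k] [CharZero k] (n : ℕ) (hn : 0 < n)
    (G : Type*) [Group G] (f : G →* Matrix.GeneralLinearGroup (Fin n) k)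
    (hf : Function.Injective f) :
    Group.IsJordan G := by
  obtain ⟨J, hJ⟩ := exists_normal_abelian_index_le_of_complex_matrix n
  refine ⟨J + 1, J.succ_pos, fun K _ ↦ ?_⟩
  let entry : K × Fin n × Fin n → k := fun x ↦ f x.1 x.2.1 x.2.2
  let L := Algebra.adjoin ℚ (Set.range entry)
  have : Countable L := by
    have h : L = (MvPolynomial.aeval entry).range := Algebra.adjoin_range_eq_range_aeval ℚ entry
    have : Countable (MvPolynomial (K × Fin n × Fin n) ℚ) :=
      Cardinal.mk_le_aleph0_iff.1 (MvPolynomial.cardinalMk_le_max_lift.trans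
        (by simp [-Cardinal.mk_prod]))
    rw [h]
    exact (MvPolynomial.aeval (R := ℚ) entry).rangeRestrict_surjective.countable
  obtain ⟨φ, hφ⟩ := exists_injective_ringHom_complex L
  have hmem (g : K) (i j : Fin n) : f g i j ∈ L := Algebra.subset_adjoin ⟨(g, i, j), rfl⟩
  let ρ : K →* Matrix (Fin n) (Fin n) L :=
    { toFun g := Matrix.of fun i j ↦ ⟨f g i j, hmem g i j⟩
      map_one' := by
        ext i j
        rcases eq_or_ne i j with rfl | hij
        · simp
        · simp [hij]
      map_mul' g h := by
        ext i j
        simp [Matrix.mul_apply] }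
  have hρ : Function.Injective ρ := fun g h hgh ↦ Subtype.ext <| hf <| Units.ext <| by
    ext i j
    exact congrArg Subtype.val (congrFun (congrFun hgh i) j)
  obtain ⟨A, hA, hcomm, hidx⟩ := hJ K ((RingHom.mapMatrix φ).toMonoidHom.comp ρ) <|
    (Matrix.map_injective hφ).comp hρ
  exact ⟨A, hA, hcomm, hidx.trans J.le_succ⟩
end

section
/- Let H be a finite normal subgroup of a group G. If G is Jordan, then the quotient group G/H is Jordan. -/
/-- The preimage of a finite subgroup under a homomorphism with finite kernel is finite. -/
theorem Subgroup.finite_comap_of_finite_ker {G G' : Type*} [Group G] [Group G'] (f : G →* G')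
    (hf : Finite f.ker) (K : Subgroup G') (hK : Finite K) : Finite (K.comap f) := by
  have h : (f ⁻¹' (K : Set G')).Finite := by
    refine Set.Finite.preimage' (Set.toFinite (K : Set G')) fun b _ => ?_
    rcases (f ⁻¹' {b}).eq_empty_or_nonempty with he | ⟨x, rfl⟩
    · rw [he]
      exact Set.finite_empty
    · refine ((Set.toFinite (f.ker : Set G)).image (x * ·)).subset fun y hy => ?_
      refine ⟨x⁻¹ * y, ?_, mul_inv_cancel_left x y⟩
      have hy' : f y = f x := hy
      simp [MonoidHom.mem_ker, hy']
  exact h.to_subtype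

theorem isJordan_quotient_of_finite_normal (G : Type*) [Group G] (H : Subgroup G) [H.Normal]
    (hH : Finite H) (hG : Group.IsJordan G) :
    Group.IsJordan (G ⧸ H) := by
  obtain ⟨J, hJ, hG⟩ := hG
  refine ⟨J, hJ, fun K hK => ?_⟩
  have hfin : Finite (K.comap (QuotientGroup.mk' H)) :=
    Subgroup.finite_comap_of_finite_ker _ (by rwa [QuotientGroup.ker_mk']) K hK
  obtain ⟨A, hA, hcomm, hindex⟩ := hG _ hfin
  have hsurj := (QuotientGroup.mk' H).subgroupComap_surjective_of_surjective K
    (QuotientGroup.mk'_surjective H)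
  refine ⟨A.map ((QuotientGroup.mk' H).subgroupComap K), hA.map _ hsurj, ?_, ?_⟩
  · rintro ⟨_, a, ha, rfl⟩ ⟨_, b, hb, rfl⟩
    have hab : a * b = b * a := congrArg Subtype.val (hcomm ⟨a, ha⟩ ⟨b, hb⟩)
    apply Subtype.ext
    simp only [Subgroup.coe_mul, ← map_mul, hab]
  · exact (Nat.le_of_dvd (Nat.pos_of_ne_zero A.index_ne_zero_of_finite)
      (A.index_map_dvd hsurj)).trans hindex
end

section
/- Let H be a normal subgroup of a group G such that the quotient group G/H is bounded. Then G is Jordan if and only if H is Jordan. -/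
/-- A group `G` is bounded if there is a positive integer `b` such that every finite
subgroup of `G` has order at most `b`. -/
def Group.IsBoundedGroup (G : Type*) [Group G] : Prop :=
  ∃ b : ℕ, 0 < b ∧ ∀ K : Subgroup G, Finite K → Nat.card K ≤ b

/-- The Jordan bound on finite subgroups of `G` holds for every finite group embedded in `G`. -/
theorem exists_normal_abelian_of_injective {G : Type*} [Group G] {J : ℕ}
    (hJ : ∀ K : Subgroup G, Finite K →
      ∃ A : Subgroup K, A.Normal ∧ (∀ a b : A, a * b = b * a) ∧ A.index ≤ J)
    {F : Type*} [Group F] [Finite F] (f : F →* G) (hf : Function.Injective f) :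
    ∃ A : Subgroup F, A.Normal ∧ (∀ a b : A, a * b = b * a) ∧ A.index ≤ J := by
  obtain ⟨A, hA, hcomm, hindex⟩ :=
    hJ f.range (Finite.of_surjective _ f.rangeRestrict_surjective)
  refine ⟨A.comap f.rangeRestrict, inferInstance, fun a b => ?_, ?_⟩
  · apply Subtype.ext
    apply hf
    simpa [Subtype.ext_iff] using hcomm ⟨_, a.2⟩ ⟨_, b.2⟩
  · rwa [Subgroup.index_comap_of_surjective _ f.rangeRestrict_surjective]

theorem Subgroup.index_normalCore_le_factorial {G : Type*} [Group G] (H : Subgroup G)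
    [H.FiniteIndex] : H.normalCore.index ≤ H.index.factorial := by
  rw [Subgroup.normalCore_eq_ker, Subgroup.index_ker, Subgroup.index, ← Nat.card_perm]
  exact Subgroup.card_le_card_group _

theorem isJordan_iff_of_bounded_quotient (G : Type*) [Group G] (H : Subgroup G) [H.Normal]
    (hquot : Group.IsBoundedGroup (G ⧸ H)) :
    Group.IsJordan G ↔ Group.IsJordan H := by
  constructor
  · rintro ⟨J, hpos, hJ⟩
    exact ⟨J, hpos, fun K _ => exists_normal_abelian_of_injective hJ (H.subtype.comp K.subtype)
      (H.subtype_injective.comp K.subtype_injective)⟩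
  · rintro ⟨J, _, hJ⟩
    obtain ⟨b, _, hb⟩ := hquot
    refine ⟨(J * b).factorial, Nat.factorial_pos _, fun K _ => ?_⟩
    have hN : (H.subgroupOf K).index ≤ b := by
      have h := Subgroup.relIndex_ker K (QuotientGroup.mk' H)
      rw [QuotientGroup.ker_mk'] at h
      exact h.trans_le (hb _ (Set.Finite.to_subtype ((K : Set G).toFinite.image _)))
    let f : H.subgroupOf K →* H := K.subtype.subgroupComap H
    have hf : Function.Injective f := fun x y hxy =>
      Subtype.ext (Subtype.ext (congrArg (fun z : H => (z : G)) hxy))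
    obtain ⟨A, _, hcomm, hA⟩ := exists_normal_abelian_of_injective hJ f hf
    let B := A.map (H.subgroupOf K).subtype
    have hB : B.index ≤ J * b := by
      rw [Subgroup.index_map_subtype]
      exact Nat.mul_le_mul hA hN
    refine ⟨B.normalCore, inferInstance, ?_,
      B.index_normalCore_le_factorial.trans (Nat.factorial_le hB)⟩
    rintro ⟨x, hx⟩ ⟨y, hy⟩
    obtain ⟨u, hu, rfl⟩ := B.normalCore_le hx
    obtain ⟨v, hv, rfl⟩ := B.normalCore_le hy
    exact Subtype.ext (congrArg (fun z : A => ((z : H.subgroupOf K) : K)) (hcomm ⟨u, hu⟩ ⟨v, hv⟩))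
end

section
/- Let H be a finite normal subgroup of a group G such that the center of H is trivial. If the quotient group G/H is Jordan, then G is Jordan. -/
/-- If `H` is normal with trivial center, then two elements which centralize `H` and commute
modulo `H` commute. -/
theorem Subgroup.commute_of_conjNormal_eq_one_of_center_eq_bot {G : Type*} [Group G]
    {H : Subgroup G} [H.Normal] (hcenter : Subgroup.center H = ⊥) {x y : G}
    (hx : MulAut.conjNormal x = (1 : MulAut H)) (hy : MulAut.conjNormal y = (1 : MulAut H))
    (hxy : (x : G ⧸ H) * y = y * x) : x * y = y * x := by
  have hmem : x * y * (y * x)⁻¹ ∈ H := by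
    rw [← QuotientGroup.eq_one_iff]
    simp only [QuotientGroup.mk_mul, QuotientGroup.mk_inv, hxy, mul_inv_cancel]
  have hone : MulAut.conjNormal (x * y * (y * x)⁻¹) = (1 : MulAut H) := by
    simp [hx, hy]
  have hcen : (⟨x * y * (y * x)⁻¹, hmem⟩ : H) ∈ Subgroup.center H := by
    rw [Subgroup.mem_center_iff]
    intro h
    have h1 : (MulAut.conjNormal (x * y * (y * x)⁻¹) h : G) = h := by
      rw [hone, MulAut.one_apply]
    rw [MulAut.conjNormal_apply] at h1
    exact Subtype.ext (mul_inv_eq_iff_eq_mul.mp h1).symm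
  rw [hcenter, Subgroup.mem_bot] at hcen
  exact mul_inv_eq_one.mp (congrArg Subtype.val hcen)

theorem isJordan_of_finite_normal_centerless (G : Type*) [Group G] (H : Subgroup G) [H.Normal]
    (hfin : Finite H) (hcenter : Subgroup.center H = ⊥)
    (hquot : Group.IsJordan (G ⧸ H)) :
    Group.IsJordan G := by
  obtain ⟨J, hJ, hquot⟩ := hquot
  have : Finite (MulAut H) := Finite.of_injective _ (DFunLike.coe_injective (F := MulAut H))
  refine ⟨J * Nat.card (MulAut H), Nat.mul_pos hJ Nat.card_pos, fun K hK => ?_⟩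
  obtain ⟨A, hAnormal, hAcomm, hAindex⟩ := hquot (K.map (QuotientGroup.mk' H))
    (Finite.of_surjective _ ((QuotientGroup.mk' H).subgroupMap_surjective K))
  let π := (QuotientGroup.mk' H).subgroupMap K
  let φ : K →* MulAut H := MulAut.conjNormal.comp K.subtype
  refine ⟨A.comap π ⊓ φ.ker, inferInstance, ?_, ?_⟩
  · rintro ⟨a, haA, haφ⟩ ⟨b, hbA, hbφ⟩
    have hab := congrArg (fun z : A => ((z : K.map (QuotientGroup.mk' H)) : G ⧸ H))
      (hAcomm ⟨π a, haA⟩ ⟨π b, hbA⟩)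
    exact Subtype.ext (Subtype.ext
      (Subgroup.commute_of_conjNormal_eq_one_of_center_eq_bot hcenter haφ hbφ hab))
  · calc (A.comap π ⊓ φ.ker).index ≤ (A.comap π).index * φ.ker.index := Subgroup.index_inf_le
      _ ≤ J * Nat.card (MulAut H) := by
        gcongr
        · rwa [Subgroup.index_comap_of_surjective A
            ((QuotientGroup.mk' H).subgroupMap_surjective K)]
        · rw [Subgroup.index_ker]
          exact Subgroup.card_le_card_group _
end

section
/- For every positive integer n, the group GL_n(ℚ) is bounded; that is, there exists a positive integer b, depending only on n, such that every finite subgroup of GL_n(ℚ) has order at most b. -/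
open Polynomial in
theorem Matrix.eq_one_of_pow_eq_one_of_roots_charpoly_eq_one {K ι : Type*} [Field K]
    [IsAlgClosed K] [CharZero K] [Fintype ι] [DecidableEq ι] {A : Matrix ι ι K} {m : ℕ}
    (hm : m ≠ 0) (hA : A ^ m = 1) (h : ∀ z ∈ A.charpoly.roots, z = 1) : A = 1 := by
  have hsep : Squarefree (minpoly K A) := by
    have hdvd : minpoly K A ∣ X ^ m - C 1 := minpoly.dvd K A (by simp [hA])
    exact ((separable_X_pow_sub_C (1 : K) (by exact_mod_cast hm) one_ne_zero).of_dvd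
      hdvd).squarefree
  have hchar : A.charpoly = (X - C 1) ^ Multiset.card A.charpoly.roots := by
    conv_lhs => rw [(IsAlgClosed.splits A.charpoly).eq_prod_roots_of_monic A.charpoly_monic,
      Multiset.eq_replicate_card.mpr h]
    simp
  have hdvd : minpoly K A ∣ (X - C 1) ^ (Multiset.card A.charpoly.roots + 1) := by
    rw [pow_succ, ← hchar]
    exact (Matrix.minpoly_dvd_charpoly A).mul_right _
  have := (hsep.dvd_pow_iff_dvd (Nat.succ_ne_zero _)).mp hdvd
  have h0 := (minpoly.dvd_iff (A := K) (x := A)).mp this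
  simpa [sub_eq_zero] using h0

theorem Matrix.pow_eq_one_of_mem_roots_charpoly {K ι : Type*} [Field K]
    [Fintype ι] [DecidableEq ι] {A : Matrix ι ι K} {m : ℕ} (hA : A ^ m = 1) {z : K}
    (hz : z ∈ A.charpoly.roots) : z ^ m = 1 := by
  have hroot := (Polynomial.mem_roots'.mp hz).2
  cases isEmpty_or_nonempty ι with
  | inl _ => simp at hz
  | inr _ =>
    have hs := spectrum.pow_mem_pow A m (Matrix.mem_spectrum_of_isRoot_charpoly hroot)
    rwa [hA, spectrum.one_eq, Set.mem_singleton_iff] at hs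

theorem Multiset.re_sum_le_card_of_norm_le_one {s : Multiset ℂ} (hs : ∀ z ∈ s, ‖z‖ ≤ 1) :
    s.sum.re ≤ s.card ∧ (s.sum.re = s.card → ∀ z ∈ s, z.re = 1) := by
  induction s using Multiset.induction with
  | empty => simp
  | cons a s ih =>
    obtain ⟨hle, heq⟩ := ih fun z hz => hs z (Multiset.mem_cons_of_mem hz)
    have ha := (Complex.re_le_norm a).trans (hs a (Multiset.mem_cons_self a s))
    simp only [Multiset.sum_cons, Complex.add_re, Multiset.card_cons, Nat.cast_add, Nat.cast_one,
      Multiset.mem_cons, forall_eq_or_imp]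
    exact ⟨by linarith, fun h => ⟨by linarith, heq (by linarith)⟩⟩

theorem Matrix.trace_map_rat_eq_sum_roots {n : ℕ} (A : Matrix (Fin n) (Fin n) ℚ) :
    (A.trace : ℂ) = (A.map (algebraMap ℚ ℂ)).charpoly.roots.sum := by
  rw [← Matrix.trace_eq_sum_roots_charpoly]
  simp [Matrix.trace]

theorem Matrix.card_roots_charpoly_complex {n : ℕ} (A : Matrix (Fin n) (Fin n) ℂ) :
    Multiset.card A.charpoly.roots = n := by
  rw [← (IsAlgClosed.splits A.charpoly).natDegree_eq_card_roots, Matrix.charpoly_natDegree_eq_dim,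
    Fintype.card_fin]

theorem Matrix.map_rat_complex_pow_eq_one {n m : ℕ} {A : Matrix (Fin n) (Fin n) ℚ}
    (hA : A ^ m = 1) : A.map (algebraMap ℚ ℂ) ^ m = 1 := by
  rw [← RingHom.mapMatrix_apply, ← map_pow, hA, map_one]

theorem Matrix.exists_int_trace_eq_of_pow_eq_one {n m : ℕ} (hm : m ≠ 0)
    {A : Matrix (Fin n) (Fin n) ℚ} (hA : A ^ m = 1) :
    ∃ z ∈ Finset.Icc (-n : ℤ) n, A.trace = z := by
  have hroot {z : ℂ} (hz : z ∈ (A.map (algebraMap ℚ ℂ)).charpoly.roots) : z ^ m = 1 :=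
    Matrix.pow_eq_one_of_mem_roots_charpoly (Matrix.map_rat_complex_pow_eq_one hA) hz
  have hint : IsIntegral ℤ (algebraMap ℚ ℂ A.trace) := by
    rw [eq_ratCast, Matrix.trace_map_rat_eq_sum_roots]
    refine IsIntegral.multiset_sum fun z hz => ?_
    exact IsIntegral.of_pow (Nat.pos_of_ne_zero hm) (by rw [hroot hz]; exact isIntegral_one)
  rw [isIntegral_algebraMap_iff (algebraMap ℚ ℂ).injective] at hint
  obtain ⟨z, hz⟩ := IsIntegrallyClosed.isIntegral_iff.mp hint
  refine ⟨z, ?_, by simpa using hz.symm⟩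
  have hnorm : ‖(A.trace : ℂ)‖ ≤ n := by
    rw [Matrix.trace_map_rat_eq_sum_roots]
    refine (norm_multiset_sum_le _).trans ((Multiset.sum_le_card_nsmul _ 1 ?_).trans ?_)
    · simp only [Multiset.mem_map, forall_exists_index, and_imp, forall_apply_eq_imp_iff₂]
      exact fun z hz => (Complex.norm_eq_one_of_pow_eq_one (hroot hz) hm).le
    · simp [Matrix.card_roots_charpoly_complex]
  rw [← hz] at hnorm
  have habs : |(z : ℝ)| ≤ n := by simpa using hnorm
  rw [Finset.mem_Icc, ← abs_le]
  exact_mod_cast habs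

theorem Matrix.eq_one_of_pow_eq_one_of_trace_eq {n m : ℕ} (hm : m ≠ 0)
    {A : Matrix (Fin n) (Fin n) ℚ} (hA : A ^ m = 1) (htr : A.trace = n) : A = 1 := by
  have hmap := Matrix.map_rat_complex_pow_eq_one hA
  have hnorm : ∀ z ∈ (A.map (algebraMap ℚ ℂ)).charpoly.roots, ‖z‖ = 1 := fun z hz =>
    Complex.norm_eq_one_of_pow_eq_one (Matrix.pow_eq_one_of_mem_roots_charpoly hmap hz) hm
  have hre := (Multiset.re_sum_le_card_of_norm_le_one fun z hz => (hnorm z hz).le).2 (by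
    rw [← Matrix.trace_map_rat_eq_sum_roots, Matrix.card_roots_charpoly_complex, htr]
    simp)
  have hone := Matrix.eq_one_of_pow_eq_one_of_roots_charpoly_eq_one hm hmap fun z hz => by
    have hsq := Complex.sq_norm z
    rw [hnorm z hz, Complex.normSq_apply, hre z hz] at hsq
    exact Complex.ext (hre z hz) (by simpa using hsq)
  apply Matrix.map_injective (algebraMap ℚ ℂ).injective
  simpa using hone

theorem Subgroup.card_le_of_finite_GL_rat {n : ℕ}
    (K : Subgroup (Matrix.GeneralLinearGroup (Fin n) ℚ)) [Finite K] :
    Nat.card K ≤ (2 * n + 1) ^ (n * n) := by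
  let v : K →* Matrix (Fin n) (Fin n) ℚ := (Units.coeHom _).comp K.subtype
  have hv_pow (g : K) : v g ^ Nat.card K = 1 := by rw [← map_pow, pow_card_eq_one', map_one]
  have hcard : Nat.card K ≠ 0 := Nat.card_pos.ne'
  obtain ⟨κ, a, ha, hspan, hli⟩ := exists_linearIndependent' ℚ v
  have : Finite κ := Finite.of_injective a ha
  have := Fintype.ofFinite κ
  have hκ : Fintype.card κ ≤ n * n := by
    simpa [Module.finrank_matrix] using hli.fintype_card_le_finrank
  choose t ht htr using fun g : K => Matrix.exists_int_trace_eq_of_pow_eq_one hcard (hv_pow g)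
  let f : K → κ → Finset.Icc (-n : ℤ) n := fun g i => ⟨t (g * a i), ht _⟩
  have hf : Function.Injective f := by
    intro g h hgh
    let φ (k : K) : Matrix (Fin n) (Fin n) ℚ →ₗ[ℚ] ℚ :=
      Matrix.traceLinearMap (Fin n) ℚ ℚ ∘ₗ LinearMap.mulLeft ℚ (v k)
    have heq : Set.EqOn (φ g) (φ h) (Set.range (v ∘ a)) := by
      rintro _ ⟨i, rfl⟩
      have hi : t (g * a i) = t (h * a i) := congrArg Subtype.val (congrFun hgh i)
      change (v g * v (a i)).trace = (v h * v (a i)).trace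
      rw [← map_mul, ← map_mul, htr, htr, hi]
    have hinv : φ g (v h⁻¹) = φ h (v h⁻¹) :=
      LinearMap.eqOn_span heq (hspan ▸ Submodule.subset_span ⟨h⁻¹, rfl⟩)
    change (v g * v h⁻¹).trace = (v h * v h⁻¹).trace at hinv
    rw [← map_mul, ← map_mul, mul_inv_cancel, map_one, Matrix.trace_one, Fintype.card_fin] at hinv
    have hone := Matrix.eq_one_of_pow_eq_one_of_trace_eq hcard (hv_pow _) hinv
    exact mul_inv_eq_one.mp (Subtype.ext (Units.ext hone))
  calc Nat.card K ≤ Nat.card (κ → Finset.Icc (-n : ℤ) n) := Nat.card_le_card_of_injective f hf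
    _ = (2 * n + 1) ^ Fintype.card κ := by
      rw [Nat.card_fun, Nat.card_eq_fintype_card, Nat.card_eq_fintype_card, Fintype.card_coe,
        Int.card_Icc]
      congr 1
      omega
    _ ≤ (2 * n + 1) ^ (n * n) := Nat.pow_le_pow_right (by omega) hκ

theorem GL_rat_isBounded (n : ℕ) (hn : 0 < n) :
    Group.IsBoundedGroup (Matrix.GeneralLinearGroup (Fin n) ℚ) := by
  exact ⟨(2 * n + 1) ^ (n * n), by positivity, fun K _ => K.card_le_of_finite_GL_rat⟩
end

section
/- Let k be an algebraically closed field of characteristic zero and let A be an integral domain that is a finitely generated commutative k-algebra generated as a k-algebra by its group of units A*. Then the group of k-algebra automorphisms of A is a Jordan group. -/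
section

open scoped nonZeroDivisors
open IsDedekindDomain WithZero

namespace MvPolynomial

/-- The valuation `p ↦ exp (deg p)` given by the total degree. -/
noncomputable def totalDegreeValuation (σ k : Type*) [Field k] :
    Valuation (MvPolynomial σ k) ℤᵐ⁰ where
  toFun p := open scoped Classical in if p = 0 then 0 else exp (p.totalDegree : ℤ)
  map_zero' := by simp
  map_one' := by simp
  map_mul' p q := by
    by_cases hp : p = 0
    · simp [hp]
    by_cases hq : q = 0
    · simp [hq]
    simp [hp, hq, totalDegree_mul_of_isDomain hp hq, exp_add]
  map_add_le_max' p q := by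
    by_cases hpq : p + q = 0
    · simp [hpq]
    by_cases hp : p = 0
    · have hq : q ≠ 0 := by simpa [hp] using hpq
      simp [hp, hq]
    by_cases hq : q = 0
    · simp [hq, hp]
    simpa [hp, hq, hpq] using totalDegree_add p q

theorem totalDegreeValuation_apply_of_ne_zero {σ k : Type*} [Field k] {p : MvPolynomial σ k}
    (hp : p ≠ 0) : totalDegreeValuation σ k p = exp (p.totalDegree : ℤ) := by
  classical exact if_neg hp

theorem exists_C_eq_of_totalDegreeValuation_le_one {σ k : Type*} [Field k] {p : MvPolynomial σ k}
    (hp : totalDegreeValuation σ k p ≤ 1) : ∃ c, C c = p := by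
  by_cases h : p = 0
  · exact ⟨0, by simp [h]⟩
  rw [totalDegreeValuation_apply_of_ne_zero h, ← exp_zero, exp_le_exp] at hp
  exact ⟨_, (totalDegree_eq_zero_iff_eq_C.mp (by lia)).symm⟩

end MvPolynomial

theorem IsDedekindDomain.HeightOneSpectrum.finite_of_isIntegral (R B : Type*) [CommRing R]
    [IsDomain R] [IsDiscreteValuationRing R] [CommRing B] [IsDedekindDomain B] [Algebra R B]
    [Module.IsTorsionFree R B] [Algebra.IsIntegral R B] : Finite (HeightOneSpectrum B) := by
  have h (w : HeightOneSpectrum B) :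
      w.asIdeal ∈ (IsLocalRing.maximalIdeal R).primesOver B := by
    refine ⟨w.isPrime, ⟨?_⟩⟩
    exact (IsLocalRing.eq_maximalIdeal
      (Ring.DimensionLEOne.maximalOfPrime (w.under R).ne_bot (w.under R).isPrime)).symm
  have := (IsDedekindDomain.primesOver_finite (IsLocalRing.maximalIdeal R) B).to_subtype
  exact Finite.of_injective (fun w ↦ (⟨w.asIdeal, h w⟩ : (IsLocalRing.maximalIdeal R).primesOver B))
    fun a b hab ↦ HeightOneSpectrum.ext (Subtype.ext_iff.mp hab)

/-- Over a finite separable extension `L` of a discretely valued field `K`, the finitely many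
extensions of the valuation to `L` detect integrality. -/
theorem Valuation.exists_units_hom_isIntegral {K L : Type*} [Field K] [Field L]
    [Algebra K L] [FiniteDimensional K L] [Algebra.IsSeparable K L] (v : Valuation K ℤᵐ⁰) [v.IsNontrivial] :
    ∃ (n : ℕ) (φ : Lˣ →* (Fin n → Multiplicative ℤ)),
      ∀ u, φ u = 1 → IsIntegral v.valuationSubring (u : L) := by
  have : IsDiscreteValuationRing v.valuationSubring := by
    infer_instance
  let B := integralClosure v.valuationSubring L
  have : IsDedekindDomain B := integralClosure.isDedekindDomain _ K L
  have : IsFractionRing B L := integralClosure.isFractionRing_of_finite_extension K L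
  have : Finite (HeightOneSpectrum B) :=
    HeightOneSpectrum.finite_of_isIntegral v.valuationSubring B
  obtain ⟨n, ⟨e⟩⟩ := Finite.exists_equiv_fin (HeightOneSpectrum B)
  refine ⟨n, MonoidHom.pi fun i ↦ unitsWithZeroEquiv.toMonoidHom.comp
    (Units.map ((e.symm i).valuation L).toMonoidWithZeroHom.toMonoidHom), fun u hu ↦ ?_⟩
  obtain ⟨b, hb⟩ := HeightOneSpectrum.mem_integers_of_valuation_le_one (R := B) L (u : L) fun w ↦ by
    have h : Units.map (w.valuation L).toMonoidWithZeroHom.toMonoidHom u = 1 :=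
      unitsWithZeroEquiv.injective <| by
        have := congr_fun hu (e w)
        rw [map_one]
        simpa using this
    exact (congr_arg Units.val h).le
  rw [← hb]
  exact b.2

/-- Units of a finitely generated domain modulo constants embed in some `ℤⁿ`: such a unit is
constant as soon as it is a unit at all places over the total degree valuation of a Noether
normalization. -/
theorem exists_units_hom_fin_int (k A : Type*) [Field k] [IsAlgClosed k]
    [CharZero k] [CommRing A] [IsDomain A] [Algebra k A] [Algebra.FiniteType k A] :
    ∃ (n : ℕ) (φ : Aˣ →* (Fin n → Multiplicative ℤ)),
      ∀ u, φ u = 1 → ∃ c : k, algebraMap k A c = u := by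
  have key (a : A) (h : IsIntegral k a) : ∃ c : k, algebraMap k A c = a := by
    obtain ⟨c, hc⟩ := (IsAlgClosed.algebraMap_bijective_of_isIntegral
      (k := k) (K := integralClosure k A)).2 ⟨a, h⟩
    exact ⟨c, congr_arg Subtype.val hc⟩
  obtain ⟨s, g, hg, hfin⟩ := exists_finite_inj_algHom_of_fg k A
  let P := MvPolynomial (Fin s) k
  let _ : Algebra P A := g.toRingHom.toAlgebra
  have : IsScalarTower k P A := .of_algHom g
  have : Module.Finite P A := hfin
  have : FaithfulSMul P A := (faithfulSMul_iff_algebraMap_injective P A).mpr hg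
  obtain rfl | hs := Nat.eq_zero_or_pos s
  · refine ⟨0, 1, fun u _ ↦ key _ ?_⟩
    have : Algebra.IsIntegral k P :=
      Algebra.isIntegral_of_surjective (MvPolynomial.C_surjective (Fin 0))
    exact isIntegral_trans (A := P) _ (Algebra.IsIntegral.isIntegral (u : A))
  let K := FractionRing P
  let L := FractionRing A
  let _ : Algebra K L := FractionRing.liftAlgebra P L
  have : FiniteDimensional K L := inferInstance
  let v : Valuation K ℤᵐ⁰ := (MvPolynomial.totalDegreeValuation (Fin s) k).extendToLocalization
    (S := P⁰) (fun x hx h ↦ by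
      rw [SetLike.mem_coe, Valuation.mem_supp_iff,
        MvPolynomial.totalDegreeValuation_apply_of_ne_zero (nonZeroDivisors.ne_zero hx)] at h
      exact exp_ne_zero h) K
  have hv (p : P) : v (algebraMap P K p) = MvPolynomial.totalDegreeValuation (Fin s) k p :=
    Valuation.extendToLocalization_apply_map_apply ..
  have : v.IsNontrivial := by
    refine ⟨algebraMap P K (MvPolynomial.X ⟨0, hs⟩), ?_⟩
    rw [hv, MvPolynomial.totalDegreeValuation_apply_of_ne_zero (MvPolynomial.X_ne_zero _),
      MvPolynomial.totalDegree_X]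
    exact ⟨exp_ne_zero, by decide⟩
  have : CharZero K := inferInstance
  obtain ⟨n, φ, hφ⟩ := v.exists_units_hom_isIntegral (L := L)
  refine ⟨n, φ.comp (Units.map (algebraMap A L).toMonoidHom), fun u hu ↦ key _ ?_⟩
  have hR := hφ _ hu
  have hP : IsIntegral P (u : A) := Algebra.IsIntegral.isIntegral _
  have e1 := minpoly.isIntegrallyClosed_eq_field_fractions K L hP
  have e2 := minpoly.isIntegrallyClosed_eq_field_fractions' K hR
  have hc (i : ℕ) : ∃ c, MvPolynomial.C c = (minpoly P (u : A)).coeff i := by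
    apply MvPolynomial.exists_C_eq_of_totalDegreeValuation_le_one
    rw [← hv, ← Polynomial.coeff_map, ← e1]
    rw [show minpoly K (algebraMap A L u) = _ from e2, Polynomial.coeff_map]
    exact ((minpoly v.valuationSubring (algebraMap A L u)).coeff i).2
  obtain ⟨q, hq⟩ : ∃ q : Polynomial k, q.map (algebraMap k P) = minpoly P (u : A) := by
    rw [← Polynomial.mem_lifts, Polynomial.lifts_iff_coeff_lifts]
    exact hc
  refine ⟨q, ?_, ?_⟩
  · have := minpoly.monic hP
    rw [← hq] at this
    exact Polynomial.monic_of_injective (algebraMap k P).injective this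
  · have := minpoly.aeval P (u : A)
    rwa [← hq, Polynomial.aeval_map_algebraMap] at this

end

theorem AddMonoid.End.exists_pow_apply_sub_eq_nsmul {M : Type*} [AddCommGroup M] {n : ℕ}
    {f : AddMonoid.End M} (h : ∀ x, ∃ y, f x - x = n • y) (i : ℕ) (x : M) :
    ∃ y, (f ^ i) x - x = n • y := by
  induction i with
  | zero => exact ⟨0, by simp⟩
  | succ i ih =>
    obtain ⟨y, hy⟩ := ih
    obtain ⟨z, hz⟩ := h ((f ^ i) x)
    refine ⟨z + y, ?_⟩
    rw [pow_succ', AddMonoid.End.coe_mul, Function.comp_apply, smul_add, ← hy, ← hz]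
    abel

/-- If `f` is an additive endomorphism of finite order `m`, congruent to `1` modulo `p` coprime to
`m`, on a group embedded in `ℤⁿ`, then `f = 1`. -/
theorem AddMonoid.End.eq_one_of_pow_eq_one_of_modEq {M ι : Type*} [AddCommGroup M]
    (φ : M →+ (ι → ℤ)) (hφ : Function.Injective φ) {m p : ℕ} (hp : 1 < p) (hm : m.Coprime p)
    (f : AddMonoid.End M) (hf : f ^ m = 1) (h : ∀ x, ∃ y, f x - x = p • y) : f = 1 := by
  have hcancel (x : M) (hx : p • x = 0) : x = 0 := by
    apply hφ
    ext i
    have := congr_fun (congr_arg φ hx) i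
    simpa [show p ≠ 0 by lia] using this
  have hdiv (z : M) (hz : ∑ i ∈ Finset.range m, (f ^ i) z = 0) : ∃ y, z = p • y := by
    choose y hy using fun i ↦ exists_pow_apply_sub_eq_nsmul h i z
    have h1 : m • z = p • (-∑ i ∈ Finset.range m, y i) := by
      rw [smul_neg, Finset.smul_sum, ← Finset.sum_congr rfl fun i _ ↦ hy i,
        Finset.sum_sub_distrib, hz]
      simp
    obtain ⟨a, b, hab⟩ := Nat.isCoprime_iff_coprime.mpr hm
    refine ⟨a • (-∑ i ∈ Finset.range m, y i) + b • z, ?_⟩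
    rw [smul_add, smul_comm p a, ← h1, smul_comm p b, ← natCast_zsmul, ← natCast_zsmul z p,
      smul_smul, smul_smul, ← add_smul, hab, one_smul]
  have hinf (j : ℕ) (z : M) (hz : ∑ i ∈ Finset.range m, (f ^ i) z = 0) : ∃ y, z = p ^ j • y := by
    induction j generalizing z with
    | zero => exact ⟨z, by simp⟩
    | succ j ih =>
      obtain ⟨y, rfl⟩ := hdiv z hz
      obtain ⟨w, rfl⟩ := ih y (hcancel _ (by simpa [← Finset.smul_sum] using hz))
      exact ⟨w, by rw [smul_smul, pow_succ']⟩
  ext x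
  rw [AddMonoid.End.coe_one, id_eq, ← sub_eq_zero]
  apply hφ
  ext i
  have hz : ∑ i ∈ Finset.range m, (f ^ i) (f x - x) = 0 := by
    have : ∀ i, (f ^ i) (f x - x) = (f ^ (i + 1)) x - (f ^ i) x := fun i ↦ by
      rw [map_sub, pow_succ, AddMonoid.End.coe_mul, Function.comp_apply]
    simp_rw [this]
    rw [Finset.sum_range_sub (fun i ↦ (f ^ i) x), hf]
    simp
  rw [map_zero, Pi.zero_apply]
  obtain ⟨y, hy⟩ := hinf (φ (f x - x) i).natAbs _ hz
  apply Int.eq_zero_of_abs_lt_dvd (m := (p : ℤ) ^ (φ (f x - x) i).natAbs)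
  · refine ⟨φ y i, ?_⟩
    conv_lhs => rw [hy]
    simp
  · rw [Int.abs_eq_natAbs]
    exact_mod_cast Nat.lt_pow_self hp

/-- A finite order automorphism of a group embedded in `ℤⁿ` which is trivial modulo `6` is
trivial. -/
theorem AddMonoid.End.eq_one_of_isOfFinOrder_of_modEq_six {M ι : Type*} [AddCommGroup M]
    (φ : M →+ (ι → ℤ)) (hφ : Function.Injective φ)
    (f : AddMonoid.End M) (hf : IsOfFinOrder f) (h : ∀ x, ∃ y, f x - x = 6 • y) : f = 1 := by
  by_contra hne
  have hn : orderOf f ≠ 1 := by simpa using hne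
  obtain ⟨q, hq, hdvd⟩ := Nat.exists_prime_and_dvd hn
  have hord : orderOf (f ^ (orderOf f / q)) = q := orderOf_pow_orderOf_div hf.orderOf_pos.ne' hdvd
  have hg : f ^ (orderOf f / q) = 1 := by
    have hgq := pow_orderOf_eq_one (f ^ (orderOf f / q))
    rw [hord] at hgq
    obtain rfl | hq2 := eq_or_ne q 2
    · refine eq_one_of_pow_eq_one_of_modEq φ hφ (p := 3) (by simp) (by decide) _ hgq fun x ↦ ?_
      obtain ⟨y, hy⟩ := exists_pow_apply_sub_eq_nsmul h (orderOf f / 2) x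
      exact ⟨2 • y, by rw [hy, smul_smul, show 3 * 2 = 6 by rfl]⟩
    · refine eq_one_of_pow_eq_one_of_modEq φ hφ (p := 2) (by simp)
        ((Nat.coprime_primes hq Nat.prime_two).mpr hq2) _ hgq fun x ↦ ?_
      obtain ⟨y, hy⟩ := exists_pow_apply_sub_eq_nsmul h (orderOf f / q) x
      exact ⟨3 • y, by rw [hy, smul_smul, show 2 * 3 = 6 by rfl]⟩
  rw [hg, orderOf_one] at hord
  exact hq.one_lt.ne hord

/-- The images of finite groups acting on a subgroup of `ℤⁿ` have bounded order. -/
theorem AddMonoid.End.exists_index_ker_le {M ι : Type*} [AddCommGroup M] [Finite ι]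
    (φ : M →+ (ι → ℤ)) (hφ : Function.Injective φ) :
    ∃ J, 0 < J ∧ ∀ (K : Type*) [Group K] [Finite K] (ρ : K →* AddMonoid.End M), ρ.ker.index ≤ J := by
  have : Module.Finite ℤ M := Module.Finite.of_injective φ.toIntLinearMap hφ
  let Q := M ⧸ (zsmulAddGroupHom 6 : M →+ M).range
  have : AddGroup.FG M := (Module.Finite.iff_addGroup_fg).mp ‹_›
  have : Finite Q := by
    apply Module.finite_of_fg_torsion
    rintro ⟨x⟩
    exact ⟨⟨6, by simp⟩, (QuotientAddGroup.eq_zero_iff _).mpr ⟨x, rfl⟩⟩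
  refine ⟨Nat.card (Q → Q), Nat.card_pos, fun K _ _ ρ ↦ ?_⟩
  let π : M → Q := QuotientAddGroup.mk
  have hπ : Function.Surjective π := QuotientAddGroup.mk_surjective
  let F (g : K) (x : Q) : Q := π (ρ g (Function.surjInv hπ x))
  have hF (g h : K) (hgh : F g = F h) : g⁻¹ * h ∈ ρ.ker := by
    have hf : IsOfFinOrder (ρ (g⁻¹ * h)) := ρ.isOfFinOrder (isOfFinOrder_of_finite _)
    refine eq_one_of_isOfFinOrder_of_modEq_six φ hφ _ hf fun x ↦ ?_
    obtain ⟨t, ht⟩ := QuotientAddGroup.eq.mp (Function.surjInv_eq hπ (π x))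
    obtain ⟨y, hy⟩ := QuotientAddGroup.eq.mp (congr_fun hgh (π x))
    set x' := Function.surjInv hπ (π x)
    replace ht : x = x' + (6 : ℤ) • t := by
      rw [show (6 : ℤ) • t = _ from ht]; abel
    replace hy : ρ h x' = ρ g x' + (6 : ℤ) • y := by
      rw [show (6 : ℤ) • y = _ from hy]; abel
    have hinv (z : M) : ρ g⁻¹ (ρ g z) = z := by
      change (ρ g⁻¹ * ρ g) z = z
      simp [← map_mul]
    refine ⟨ρ g⁻¹ (y + ρ h t - ρ g t), ?_⟩
    rw [← natCast_zsmul, map_mul, AddMonoid.End.coe_mul, Function.comp_apply, ht]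
    simp only [map_add, map_sub, map_zsmul, hy, hinv, Nat.cast_ofNat, smul_add, smul_sub]
    abel
  refine Nat.card_le_card_of_injective (fun q : K ⧸ ρ.ker ↦ F q.out) fun q q' h ↦ ?_
  rw [← q.out_eq, ← q'.out_eq]
  exact QuotientGroup.eq.mpr (hF _ _ h)

/-- The units of `A` modulo the constants from `k`, written additively. -/
def UnitsModConstants (k A : Type*) [Field k] [CommRing A] [Algebra k A] : Type _ :=
  Additive (Aˣ ⧸ (Units.map (algebraMap k A).toMonoidHom).range)

noncomputable instance (k A : Type*) [Field k] [CommRing A] [Algebra k A] :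
    AddCommGroup (UnitsModConstants k A) :=
  inferInstanceAs (AddCommGroup (Additive (Aˣ ⧸ (Units.map (algebraMap k A).toMonoidHom).range)))

/-- The action of the algebra automorphisms on the units modulo constants. -/
def algAutToEndUnitsModConstants (k A : Type*) [Field k] [CommRing A] [Algebra k A] :
    (A ≃ₐ[k] A) →* AddMonoid.End (UnitsModConstants k A) where
  toFun σ := MonoidHom.toAdditive <| QuotientGroup.map _ _
    (Units.map (σ : A →* A)) <| by
      rintro _ ⟨c, rfl⟩
      exact ⟨c, Units.ext (by simp)⟩
  map_one' := by
    ext x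
    obtain ⟨u, rfl⟩ := QuotientGroup.mk_surjective x
    rfl
  map_mul' σ τ := by
    ext x
    obtain ⟨u, rfl⟩ := QuotientGroup.mk_surjective x
    rfl

theorem exists_apply_unit_eq_of_mem_ker {k A : Type*} [Field k] [CommRing A] [Algebra k A]
    {σ : A ≃ₐ[k] A} (hσ : σ ∈ (algAutToEndUnitsModConstants k A).ker) (u : Aˣ) :
    ∃ c : k, σ u = algebraMap k A c * u := by
  have h := DFunLike.congr_fun (MonoidHom.mem_ker.mp hσ) (Additive.ofMul (QuotientGroup.mk u))
  obtain ⟨c, hc⟩ := QuotientGroup.eq.mp h.symm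
  refine ⟨c, ?_⟩
  have := congr_arg Units.val (eq_inv_mul_iff_mul_eq.mp hc)
  rw [mul_comm]
  exact this.symm

/-- Automorphisms acting trivially on the units modulo constants commute if the units generate. -/
theorem commute_of_mem_ker_algAutToEndUnitsModConstants {k A : Type*} [Field k] [CommRing A]
    [Algebra k A] (hunits : Algebra.adjoin k {a : A | IsUnit a} = ⊤) {σ τ : A ≃ₐ[k] A}
    (hσ : σ ∈ (algAutToEndUnitsModConstants k A).ker)
    (hτ : τ ∈ (algAutToEndUnitsModConstants k A).ker) : σ * τ = τ * σ := by
  refine AlgEquiv.coe_toAlgHom_injective (AlgHom.ext_of_adjoin_eq_top hunits ?_)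
  rintro _ ⟨u, rfl⟩
  obtain ⟨c, hc⟩ := exists_apply_unit_eq_of_mem_ker hσ u
  obtain ⟨d, hd⟩ := exists_apply_unit_eq_of_mem_ker hτ u
  change σ (τ u) = τ (σ u)
  simp only [hc, hd, map_mul, AlgEquiv.commutes]
  ring

/-- Units modulo constants of a finitely generated domain over an algebraically closed field embed
in some `ℤⁿ`. -/
theorem exists_unitsModConstants_hom_injective (k A : Type*) [Field k] [IsAlgClosed k]
    [CharZero k] [CommRing A] [IsDomain A] [Algebra k A] [Algebra.FiniteType k A] :
    ∃ (n : ℕ) (φ : UnitsModConstants k A →+ (Fin n → ℤ)), Function.Injective φ := by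
  obtain ⟨n, φ, hφ⟩ := exists_units_hom_fin_int k A
  have hker (c : kˣ) : φ (Units.map (algebraMap k A).toMonoidHom c) = 1 := by
    ext i
    let a : ℤ := (φ (Units.map (algebraMap k A).toMonoidHom c) i).toAdd
    obtain ⟨d, hd⟩ := IsAlgClosed.exists_pow_nat_eq (c : k) (n := a.natAbs + 1) (by lia)
    have hd0 : d ≠ 0 := by
      rintro rfl
      exact c.ne_zero (by simpa using hd.symm)
    have hdc : Units.mk0 d hd0 ^ (a.natAbs + 1) = c := Units.ext (by simpa using hd)
    refine Multiplicative.toAdd.injective <| Int.eq_zero_of_abs_lt_dvd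
      (m := (a.natAbs + 1 : ℕ))
      ⟨(φ (Units.map (algebraMap k A).toMonoidHom (Units.mk0 d hd0)) i).toAdd, ?_⟩
      (by change |a| < _; rw [Int.abs_eq_natAbs]; lia)
    calc a = (φ (Units.map (algebraMap k A).toMonoidHom
          (Units.mk0 d hd0 ^ (a.natAbs + 1))) i).toAdd := by rw [hdc]
      _ = _ := by rw [map_pow, map_pow, Pi.pow_apply, toAdd_pow, nsmul_eq_mul]
  let ψ : (Aˣ ⧸ (Units.map (algebraMap k A).toMonoidHom).range) →* (Fin n → Multiplicative ℤ) :=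
    QuotientGroup.lift _ φ (by rintro _ ⟨c, rfl⟩; exact hker c)
  have hψ : Function.Injective ψ := by
    rw [injective_iff_map_eq_one]
    intro x hx
    obtain ⟨u, rfl⟩ := QuotientGroup.mk_surjective x
    obtain ⟨c, hc⟩ := hφ u hx
    have hc0 : c ≠ 0 := by
      rintro rfl
      exact u.ne_zero (by simpa using hc.symm)
    exact (QuotientGroup.eq_one_iff _).mpr ⟨Units.mk0 c hc0, Units.ext hc⟩
  exact ⟨n, { toFun x := fun i ↦ (ψ x.toMul i).toAdd
              map_zero' := by ext i; exact congr_fun (map_one ψ) i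
              map_add' x y := by ext i; exact congr_fun (map_mul ψ x.toMul y.toMul) i }, fun x y h ↦ Additive.toMul.injective <| hψ <| by
    ext i
    exact congr_fun h i⟩

theorem isJordan_algAut_of_generated_by_units (k A : Type*) [Field k] [IsAlgClosed k]
    [CharZero k] [CommRing A] [IsDomain A] [Algebra k A] [Algebra.FiniteType k A]
    (hunits : Algebra.adjoin k {a : A | IsUnit a} = ⊤) :
    Group.IsJordan (A ≃ₐ[k] A) := by
  obtain ⟨n, φ, hφ⟩ := exists_unitsModConstants_hom_injective k A
  obtain ⟨J, hJ, h⟩ := AddMonoid.End.exists_index_ker_le φ hφ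
  refine ⟨J, hJ, fun K _ ↦ ?_⟩
  let ρ := (algAutToEndUnitsModConstants k A).comp K.subtype
  refine ⟨ρ.ker, inferInstance, fun a b ↦ ?_, h K ρ⟩
  ext1; ext1
  exact commute_of_mem_ker_algAutToEndUnitsModConstants hunits a.2 b.2
end

section
/- Let k be a field of characteristic zero and let A be a commutative k-algebra that is an integral domain and is generated as a k-algebra by its group of units A*. Then every locally nilpotent k-derivation of A is zero; consequently the Makar-Limanov invariant ML(A) equals A. -/
/-- A derivation `D` is locally nilpotent if for every `a` some positive iterate of `D`
kills `a`. -/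
def Derivation.IsLocallyNilpotent {k A : Type*} [CommRing k] [CommRing A] [Algebra k A]
    (D : Derivation k A A) : Prop :=
  ∀ a : A, ∃ n : ℕ, 0 < n ∧ (⇑D)^[n] a = 0

/-- The kernel of a derivation `D : A → A`, as a `k`-subalgebra of `A`. -/
def Derivation.kerSubalgebra {k A : Type*} [CommRing k] [CommRing A] [Algebra k A]
    (D : Derivation k A A) : Subalgebra k A where
  carrier := {a : A | D a = 0}
  add_mem' := by
    intro a b ha hb
    simp only [Set.mem_setOf_eq] at *
    rw [map_add, ha, hb, add_zero]
  mul_mem' := by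
    intro a b ha hb
    simp only [Set.mem_setOf_eq] at *
    rw [Derivation.leibniz, ha, hb, smul_zero, smul_zero, add_zero]
  algebraMap_mem' := fun r => by
    simp only [Set.mem_setOf_eq, Derivation.map_algebraMap]

/-- The Makar-Limanov invariant of a commutative `k`-algebra `A`: the intersection of the
kernels of all locally nilpotent `k`-derivations of `A`. -/
def MakarLimanov (k A : Type*) [CommRing k] [CommRing A] [Algebra k A] : Subalgebra k A :=
  ⨅ D : {D : Derivation k A A // D.IsLocallyNilpotent}, (D : Derivation k A A).kerSubalgebra

namespace Derivation

section CommRing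

variable {k A : Type*} [CommRing k] [CommRing A] [Algebra k A]

theorem iterate_mul_of_apply_eq_zero (D : Derivation k A A) {a : A} (ha : D a = 0) (b : A)
    (m : ℕ) : D^[m] (a * b) = a * D^[m] b := by
  induction m generalizing b with
  | zero => rfl
  | succ m ih => simp [ha, ih]

/-- The top-degree part of the higher Leibniz rule. -/
theorem exists_iterate_add_mul (D : Derivation k A A) {n m : ℕ} {a b : A}
    (ha : D^[n + 1] a = 0) (hb : D^[m + 1] b = 0) :
    ∃ c : ℕ, 0 < c ∧ D^[n + m] (a * b) = c * (D^[n] a * D^[m] b) := by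
  induction n generalizing a b m with
  | zero => exact ⟨1, one_pos, by simpa using D.iterate_mul_of_apply_eq_zero ha b m⟩
  | succ n ihn =>
    induction m generalizing b with
    | zero =>
      refine ⟨1, one_pos, ?_⟩
      simpa [mul_comm] using D.iterate_mul_of_apply_eq_zero hb a (n + 1)
    | succ m ihm =>
      obtain ⟨c, hc, h₁⟩ := ihm (b := D b) hb
      obtain ⟨d, -, h₂⟩ := ihn (a := D a) ha hb
      refine ⟨c + d, Nat.add_pos_left hc d, ?_⟩
      have hadd : n + 1 + (m + 1) = n + 1 + m + 1 := rfl
      rw [hadd, Function.iterate_succ_apply, leibniz, smul_eq_mul, smul_eq_mul, iterate_map_add,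
        h₁, mul_comm b, add_right_comm n 1 m, add_assoc n m 1, h₂]
      simp only [Function.iterate_succ_apply]
      push_cast
      ring

theorem IsLocallyNilpotent.exists_iterate_ne_zero {D : Derivation k A A}
    (hD : D.IsLocallyNilpotent) {a : A} (ha : a ≠ 0) :
    ∃ n : ℕ, D^[n] a ≠ 0 ∧ D^[n + 1] a = 0 := by
  classical
  obtain ⟨N, -, hN⟩ := hD a
  have hex : ∃ n, D^[n] a = 0 := ⟨N, hN⟩
  obtain ⟨n, hn⟩ := Nat.exists_eq_succ_of_ne_zero
    (fun h : Nat.find hex = 0 => ha (by simpa [h] using Nat.find_spec hex))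
  exact ⟨n, Nat.find_min hex (by omega), by simpa only [hn] using Nat.find_spec hex⟩

/-- The kernel of a locally nilpotent derivation of a domain of characteristic zero is
factorially closed. -/
theorem IsLocallyNilpotent.apply_eq_zero_of_mul [IsDomain A] [CharZero A]
    {D : Derivation k A A} (hD : D.IsLocallyNilpotent) {a b : A} (ha : a ≠ 0) (hb : b ≠ 0)
    (hab : D (a * b) = 0) : D a = 0 := by
  obtain ⟨n, hn, hn'⟩ := hD.exists_iterate_ne_zero ha
  obtain ⟨m, hm, hm'⟩ := hD.exists_iterate_ne_zero hb
  obtain ⟨c, hc, h⟩ := D.exists_iterate_add_mul hn' hm'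
  cases n with
  | zero => exact hn'
  | succ n =>
    have hne : (c : A) * (D^[n + 1] a * D^[m] b) ≠ 0 :=
      mul_ne_zero (Nat.cast_ne_zero.mpr hc.ne') (mul_ne_zero hn hm)
    rw [← h, Nat.add_right_comm, Function.iterate_succ_apply, hab, iterate_map_zero] at hne
    exact absurd rfl hne

theorem IsLocallyNilpotent.apply_eq_zero_of_isUnit [IsDomain A] [CharZero A]
    {D : Derivation k A A} (hD : D.IsLocallyNilpotent) {a : A} (ha : IsUnit a) : D a = 0 := by
  obtain ⟨b, hb⟩ := ha.exists_right_inv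
  exact hD.apply_eq_zero_of_mul ha.ne_zero (right_ne_zero_of_mul_eq_one hb) (by simp [hb])

end CommRing

end Derivation

theorem lnd_eq_zero_of_generated_by_units (k A : Type*) [Field k] [CharZero k]
    [CommRing A] [IsDomain A] [Algebra k A]
    (hunits : Algebra.adjoin k {a : A | IsUnit a} = ⊤) :
    (∀ D : Derivation k A A, D.IsLocallyNilpotent → D = 0) ∧ MakarLimanov k A = ⊤ := by
  have : CharZero A := charZero_of_injective_algebraMap (algebraMap k A).injective
  have h (D : Derivation k A A) (hD : D.IsLocallyNilpotent) : D = 0 :=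
    Derivation.ext_of_adjoin_eq_top _ hunits fun _ ha => hD.apply_eq_zero_of_isUnit ha
  refine ⟨h, ?_⟩
  rw [MakarLimanov, iInf_eq_top]
  rintro ⟨D, hD⟩
  rw [eq_top_iff]
  rintro a -
  change D a = 0
  rw [h D hD, Derivation.zero_apply]
end

section
/- Let k be a field of characteristic zero and let A and B be commutative k-algebras. Then the Makar-Limanov invariant ML(A ⊗_k B) is contained in the subalgebra ML(A) ⊗_k ML(B) of A ⊗_k B, i.e., in the image of ML(A) ⊗_k ML(B) under the canonical map into A ⊗_k B. -/
section

open TensorProduct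

/-- The derivation `id ⊗ E` of `A ⊗[k] B` induced by a derivation `E` of `B`. -/
noncomputable def Derivation.lTensor {k : Type*} (A : Type*) {B : Type*} [CommRing k] [CommRing A]
    [Algebra k A] [CommRing B] [Algebra k B] (E : Derivation k B B) :
    Derivation k (A ⊗[k] B) (A ⊗[k] B) :=
  Derivation.mk' (LinearMap.lTensor A (E : B →ₗ[k] B)) fun x y => by
    induction x with
    | zero => simp
    | add x x' hx hx' => simp only [add_mul, map_add, hx, hx', add_smul, smul_add]; abel
    | tmul a b =>
      induction y with
      | zero => simp
      | add y y' hy hy' => simp only [mul_add, map_add, hy, hy', add_smul, smul_add]; abel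
      | tmul a' b' => simp [tmul_add, mul_comm a' a]

/-- The derivation `D ⊗ id` of `A ⊗[k] B` induced by a derivation `D` of `A`. -/
noncomputable def Derivation.rTensor {k A : Type*} (B : Type*) [CommRing k] [CommRing A]
    [Algebra k A] [CommRing B] [Algebra k B] (D : Derivation k A A) :
    Derivation k (A ⊗[k] B) (A ⊗[k] B) :=
  Derivation.mk' (LinearMap.rTensor B (D : A →ₗ[k] A)) fun x y => by
    induction x with
    | zero => simp
    | add x x' hx hx' => simp only [add_mul, map_add, hx, hx', add_smul, smul_add]; abel
    | tmul a b =>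
      induction y with
      | zero => simp
      | add y y' hy hy' => simp only [mul_add, map_add, hy, hy', add_smul, smul_add]; abel
      | tmul a' b' => simp [add_tmul, mul_comm b' b]

section Nilpotent

variable {k A B : Type*} [CommRing k] [CommRing A] [Algebra k A] [CommRing B] [Algebra k B]

/-- Local nilpotence of a derivation of `A ⊗[k] B` may be checked on pure tensors. -/
theorem Derivation.isLocallyNilpotent_of_tmul {D : Derivation k (A ⊗[k] B) (A ⊗[k] B)}
    (h : ∀ a b, ∃ n : ℕ, 0 < n ∧ (⇑D)^[n] (a ⊗ₜ b) = 0) : D.IsLocallyNilpotent := by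
  have mono : ∀ {x} {m n : ℕ}, m ≤ n → (⇑D)^[m] x = 0 → (⇑D)^[n] x = 0 := by
    intro x m n hmn hx
    obtain ⟨c, rfl⟩ := Nat.exists_eq_add_of_le' hmn
    rw [Function.iterate_add_apply, hx, iterate_map_zero]
  intro x
  induction x with
  | zero => exact ⟨1, one_pos, map_zero D⟩
  | tmul a b => exact h a b
  | add x y hx hy =>
    obtain ⟨m, hm, hx⟩ := hx
    obtain ⟨n, hn, hy⟩ := hy
    refine ⟨m + n, by omega, ?_⟩
    rw [iterate_map_add, mono (by omega) hx, mono (by omega) hy, add_zero]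

theorem Derivation.IsLocallyNilpotent.lTensor {E : Derivation k B B} (hE : E.IsLocallyNilpotent) :
    (E.lTensor A).IsLocallyNilpotent := by
  refine Derivation.isLocallyNilpotent_of_tmul fun a b => ?_
  obtain ⟨n, hn, hb⟩ := hE b
  have h : (⇑(E.lTensor A))^[n] (a ⊗ₜ b) = a ⊗ₜ (⇑E)^[n] b :=
    (Function.Semiconj.iterate_right (f := fun b => a ⊗ₜ[k] b) (fun _ => rfl) n b).symm
  exact ⟨n, hn, by rw [h, hb, tmul_zero]⟩

theorem Derivation.IsLocallyNilpotent.rTensor {D : Derivation k A A} (hD : D.IsLocallyNilpotent) :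
    (D.rTensor B).IsLocallyNilpotent := by
  refine Derivation.isLocallyNilpotent_of_tmul fun a b => ?_
  obtain ⟨n, hn, ha⟩ := hD a
  have h : (⇑(D.rTensor B))^[n] (a ⊗ₜ b) = (⇑D)^[n] a ⊗ₜ b :=
    (Function.Semiconj.iterate_right (f := fun a => a ⊗ₜ[k] b) (fun _ => rfl) n a).symm
  exact ⟨n, hn, by rw [h, ha, zero_tmul]⟩

theorem mem_makarLimanov {a : A} :
    a ∈ MakarLimanov k A ↔ ∀ D : Derivation k A A, D.IsLocallyNilpotent → D a = 0 := by
  simp only [MakarLimanov, Algebra.mem_iInf, Subtype.forall]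
  rfl

end Nilpotent

/-- Over a field, a tensor killed by every `id ⊗ f j` comes from the common kernel of the `f j`. -/
theorem TensorProduct.mem_range_lTensor_of_forall_lTensor_eq_zero {k M N P ι : Type*} [Field k]
    [AddCommGroup M] [Module k M] [AddCommGroup N] [Module k N] [AddCommGroup P] [Module k P]
    (f : ι → N →ₗ[k] P) (K : Submodule k N) (hK : ∀ n, (∀ j, f j n = 0) → n ∈ K)
    {x : M ⊗[k] N} (hx : ∀ j, (f j).lTensor M x = 0) :
    x ∈ LinearMap.range (K.subtype.lTensor M) := by
  let b := Module.Basis.ofVectorSpace k M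
  obtain ⟨c, rfl⟩ := TensorProduct.eq_repr_basis_left b x
  simp only [Finsupp.sum, map_sum, LinearMap.lTensor_tmul] at hx ⊢
  refine Submodule.sum_mem _ fun i _ => ?_
  have hi : c i ∈ K := hK _ fun j => by
    have h := TensorProduct.sum_tmul_basis_left_eq_zero b (c.mapRange (f j) (map_zero _)) (by
      rw [Finsupp.sum_mapRange_index (by simp)]
      exact hx j)
    simpa using DFunLike.congr_fun h i
  exact ⟨b i ⊗ₜ ⟨c i, hi⟩, rfl⟩

end

open TensorProduct in
theorem makarLimanov_tensor_le (k A B : Type*) [Field k] [CharZero k]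
    [CommRing A] [Algebra k A] [CommRing B] [Algebra k B] :
    MakarLimanov k (A ⊗[k] B) ≤
      (MakarLimanov k A).map
          (Algebra.TensorProduct.includeLeft : A →ₐ[k] A ⊗[k] B) ⊔
        (MakarLimanov k B).map
          (Algebra.TensorProduct.includeRight : B →ₐ[k] A ⊗[k] B) := by
  intro x hx
  rw [mem_makarLimanov] at hx
  have hA : TensorProduct.comm k A B x ∈ LinearMap.range
      ((MakarLimanov k A).toSubmodule.subtype.lTensor B) := by
    refine TensorProduct.mem_range_lTensor_of_forall_lTensor_eq_zero
      (fun D : {D : Derivation k A A // D.IsLocallyNilpotent} => (D.1 : A →ₗ[k] A)) _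
      (fun a ha => mem_makarLimanov.2 fun D hD => ha ⟨D, hD⟩) fun D => ?_
    rw [LinearMap.lTensor_comm, show LinearMap.rTensor B (D.1 : A →ₗ[k] A) x = 0 from
      hx _ D.2.rTensor, map_zero]
  obtain ⟨y, hy⟩ := hA
  obtain ⟨z, rfl⟩ := (TensorProduct.comm k _ _).surjective y
  rw [LinearMap.lTensor_comm, EquivLike.apply_eq_iff_eq] at hy
  subst hy
  have hz : z ∈ LinearMap.range ((MakarLimanov k B).toSubmodule.subtype.lTensor
      (MakarLimanov k A).toSubmodule) := by
    refine TensorProduct.mem_range_lTensor_of_forall_lTensor_eq_zero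
      (fun E : {E : Derivation k B B // E.IsLocallyNilpotent} => (E.1 : B →ₗ[k] B)) _
      (fun b hb => mem_makarLimanov.2 fun E hE => hb ⟨E, hE⟩) fun E => ?_
    apply Module.Flat.rTensor_preserves_injective_linearMap (M := B) _
      (MakarLimanov k A).toSubmodule.injective_subtype
    have h : LinearMap.lTensor A (E.1 : B →ₗ[k] B) _ = 0 := hx _ E.2.lTensor
    rw [← LinearMap.comp_apply, LinearMap.lTensor_comp_rTensor] at h
    rw [← LinearMap.comp_apply, LinearMap.rTensor_comp_lTensor, h, map_zero]
  obtain ⟨w, rfl⟩ := hz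
  clear hx
  induction w with
  | zero => simp
  | add w w' hw hw' =>
    simp only [map_add]
    exact add_mem hw hw'
  | tmul a b =>
    have h : (a : A) ⊗ₜ[k] (b : B) =
        (Algebra.TensorProduct.includeLeft : A →ₐ[k] A ⊗[k] B) a *
          (Algebra.TensorProduct.includeRight : B →ₐ[k] A ⊗[k] B) b := by simp
    simp only [LinearMap.lTensor_tmul, LinearMap.rTensor_tmul, Submodule.subtype_apply]
    rw [h]
    exact mul_mem
      (Algebra.mem_sup_left ⟨a, a.2, rfl⟩)
      (Algebra.mem_sup_right ⟨b, b.2, rfl⟩)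
end
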